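/- arXiv:1412.5087 — 2 statements merged into one kernel-verified Lean document; each statement's English description precedes it below -/
import Mathlib

section
/- (Midpoint lower bound for a free PNG trajectory line, Lemma 6.3.) There exists a decreasing function t ↦ δ_t from (0,∞) to (0,∞) with δ_t → 0 as t → ∞, depending only on q, such that the following holds. Let t₁ < t₂ < t₃ be real numbers, let a₁, a₃ ∈ ℤ and a₂ ∈ ℝ satisfy (a₂ − a₁)/(t₂ − t₁) = (a₃ − a₂)/(t₃ − t₂) (i.e. (t₁,a₁), (t₂,a₂), (t₃,a₃) are collinear). Let g be a random element of the set G of PNG trajectory lines on [t₁, t₃] with g(t₁) = a₁ and g(t₃) = a₃, distributed with probability proportional to the weight w(g). Then P( g(t₂) ≥ a₂ ) ≥ 1/2 − δ_{min(t₂−t₁, t₃−t₂)}. -/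
open MeasureTheory Filter Set

noncomputable section

/-- The parity jump condition for (the integer values of) a PNG trajectory line on `[t₁, t₃]`:
at even integers in the interior the jump is upward or zero, at odd integers it is
downward or zero. -/
def PNGJump (t₁ t₃ : ℝ) (f : ℤ → ℤ) : Prop :=
  ∀ n : ℤ, t₁ < (n : ℝ) → (n : ℝ) < t₃ →
    (Even n → f (n - 1) ≤ f n) ∧ (Odd n → f n ≤ f (n - 1))

/-- A PNG trajectory line on `[t₁, t₃]`, encoded by its values `f k` at the integer points
(the line itself is `t ↦ f ⌊t⌋`); the values outside `[⌊t₁⌋, ⌊t₃⌋]` are normalized to be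
constant. -/
def PNGLineOn (t₁ t₃ : ℝ) : Set (ℤ → ℤ) :=
  {f | PNGJump t₁ t₃ f ∧ (∀ m : ℤ, m ≤ ⌊t₁⌋ → f m = f ⌊t₁⌋) ∧
    ∀ m : ℤ, ⌊t₃⌋ ≤ m → f m = f ⌊t₃⌋}

/-- Strict ordering `f > g` of PNG trajectory lines on `I`:
`limsup_{t→t₀} g(t) < liminf_{t→t₀} f(t)` for every `t₀ ∈ I`. -/
def PNGGt (I : Set ℝ) (f g : ℤ → ℤ) : Prop :=
  ∀ t₀ ∈ I,
    Filter.limsup (fun t : ℝ => (g ⌊t⌋ : ℝ)) (nhds t₀) <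
      Filter.liminf (fun t : ℝ => (f ⌊t⌋ : ℝ)) (nhds t₀)

/-- The weight `w(h) = ∏_{k=⌊t₁⌋+1}^{⌊t₃⌋} p(|h(k) − h(k−ε)|)`, `p(k) = √(1−q)·(√q)^k`. -/
def pngWeight (q t₁ t₃ : ℝ) (f : ℤ → ℤ) : ℝ :=
  ∏ k ∈ Finset.Icc (⌊t₁⌋ + 1) ⌊t₃⌋,
    (Real.sqrt (1 - q) * Real.sqrt q ^ (f k - f (k - 1)).natAbs)

/-- The probability of the event `E` for a random PNG trajectory line in `S` distributed
proportionally to its weight. -/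
def pngProb (q t₁ t₃ : ℝ) (S E : Set (ℤ → ℤ)) : ℝ :=
  (∑' f : ↥(S ∩ E), pngWeight q t₁ t₃ (f : ℤ → ℤ)) /
    ∑' f : ↥S, pngWeight q t₁ t₃ (f : ℤ → ℤ)

def cz (k : ℕ) (x : ℤ) : ℝ := if 0 ≤ x then (Nat.multichoose k x.toNat : ℝ) else 0

lemma cz_nonneg (k : ℕ) (x : ℤ) : 0 ≤ cz k x := by
  unfold cz; split_ifs <;> positivity

lemma cz_neg (k : ℕ) {x : ℤ} (hx : x < 0) : cz k x = 0 := by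
  unfold cz; rw [if_neg (by omega)]

lemma cz_natCast (k n : ℕ) : cz k (n : ℤ) = Nat.multichoose k n := by
  simp [cz]

lemma cz_pos {k : ℕ} (hk : 1 ≤ k) {x : ℤ} (hx : 0 ≤ x) : 0 < cz k x := by
  unfold cz; rw [if_pos hx, Nat.multichoose_eq]
  exact_mod_cast Nat.choose_pos (by omega)

lemma cz_rec (k : ℕ) (x : ℤ) : ((x : ℝ) + 1) * cz k (x + 1) = ((x : ℝ) + k) * cz k x := by
  rcases lt_trichotomy x (-1) with h | h | h
  · rw [cz_neg k (by omega), cz_neg k (by omega)]; simp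
  · subst h; rw [cz_neg k (by omega : (-1 : ℤ) < 0)]; simp
  · obtain ⟨n, rfl⟩ := Int.eq_ofNat_of_zero_le (by omega : 0 ≤ x)
    have h1 : ((n : ℤ) + 1) = ((n + 1 : ℕ) : ℤ) := by push_cast; rfl
    rw [h1, cz_natCast, cz_natCast, Nat.multichoose_eq, Nat.multichoose_eq]
    rcases Nat.eq_zero_or_pos k with hk | hk
    · subst hk
      rcases Nat.eq_zero_or_pos n with hn | hn
      · subst hn; simp
      · have : Nat.choose (0 + n - 1) n = 0 := Nat.choose_eq_zero_of_lt (by omega)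
        rw [zero_add] at this; simp [this]
    · obtain ⟨j, rfl⟩ : ∃ j, k = j + 1 := ⟨k - 1, by omega⟩
      have e1 : j + 1 + (n + 1) - 1 = (n + j) + 1 := by omega
      have e2 : j + 1 + n - 1 = n + j := by omega
      rw [e1, e2]
      have := Nat.add_one_mul_choose_eq (n + j) n
      have h' : ((n + j + 1 : ℕ) : ℝ) * ((n + j).choose n : ℝ) = ((n + j + 1).choose (n + 1) : ℝ) * ((n + 1 : ℕ) : ℝ) := by
        exact_mod_cast this
      push_cast at h' ⊢
      linarith

/-- the beta-binomial weight -/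
def rr (k k' U : ℕ) (x : ℤ) : ℝ := cz k x * cz k' ((U : ℤ) - x)

lemma rr_nonneg (k k' U : ℕ) (x : ℤ) : 0 ≤ rr k k' U x := mul_nonneg (cz_nonneg _ _) (cz_nonneg _ _)

lemma rr_support (k k' U : ℕ) (x : ℤ) (h : x ∉ Finset.Icc (0 : ℤ) U) : rr k k' U x = 0 := by
  simp only [Finset.mem_Icc, not_and_or, not_le] at h
  unfold rr
  rcases h with h | h
  · rw [cz_neg _ h, zero_mul]
  · rw [cz_neg k' (by omega), mul_zero]

lemma rr_summable (k k' U : ℕ) (h : ℤ → ℝ) : Summable (fun x => h x * rr k k' U x) :=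
  summable_of_ne_finset_zero (s := Finset.Icc (0 : ℤ) U) (fun x hx => by rw [rr_support _ _ _ _ hx, mul_zero])

lemma rr_summable' (k k' U : ℕ) : Summable (rr k k' U) := by
  simpa using rr_summable k k' U (fun _ => 1)

lemma rr_rec (k k' U : ℕ) (x : ℤ) :
    rr k k' U (x + 1) * (((x : ℝ) + 1) * ((U : ℝ) - x - 1 + k')) =
      rr k k' U x * (((x : ℝ) + k) * ((U : ℝ) - x)) := by
  unfold rr
  have h1 := cz_rec k x
  have h2 := cz_rec k' ((U : ℤ) - x - 1)
  have e : (U : ℤ) - x - 1 + 1 = U - x := by ring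
  have e' : (U : ℤ) - (x + 1) = U - x - 1 := by ring
  rw [e] at h2
  rw [e']
  push_cast at h2
  calc _ = (((x : ℝ) + 1) * cz k (x + 1)) * (((U : ℝ) - x - 1 + k') * cz k' ((U : ℤ) - x - 1)) := by ring
    _ = _ := by rw [h1, ← h2]; ring

/-- total mass -/
def TT (k k' U : ℕ) : ℝ := ∑' x : ℤ, rr k k' U x

lemma rr_stein (k k' U : ℕ) (h : ℤ → ℝ) :
    ∑' x : ℤ, (h x * ((x : ℝ) * ((U : ℝ) - x + k')) - h (x + 1) * (((x : ℝ) + k) * ((U : ℝ) - x))) * rr k k' U x = 0 := by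
  have h1 : ∑' x : ℤ, (h x * ((x : ℝ) * ((U : ℝ) - x + k'))) * rr k k' U x =
      ∑' x : ℤ, (h (x + 1) * (((x : ℝ) + k) * ((U : ℝ) - x))) * rr k k' U x := by
    rw [← (Equiv.addRight (1 : ℤ)).tsum_eq]
    apply tsum_congr
    intro x
    have := rr_rec k k' U x
    simp only [Equiv.coe_addRight]
    push_cast
    linear_combination h (x + 1) * this
  simp_rw [sub_mul]
  rw [Summable.tsum_sub (rr_summable _ _ _ _) (rr_summable _ _ _ _), h1, sub_self]

lemma rr_mean (k k' U : ℕ) :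
    ((k : ℝ) + k') * ∑' x : ℤ, (x : ℝ) * rr k k' U x = (k : ℝ) * U * TT k k' U := by
  have := rr_stein k k' U (fun _ => 1)
  have h2 : ∀ x : ℤ, ((1 : ℝ) * ((x : ℝ) * ((U : ℝ) - x + k')) - 1 * (((x : ℝ) + k) * ((U : ℝ) - x))) * rr k k' U x
      = ((k : ℝ) + k') * ((x : ℝ) * rr k k' U x) - (k : ℝ) * U * rr k k' U x := by intro x; ring
  simp only [h2] at this
  rw [Summable.tsum_sub ((rr_summable _ _ _ _).mul_left _) ((rr_summable' _ _ _).mul_left _), tsum_mul_left, tsum_mul_left] at this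
  unfold TT; linarith

lemma rr_second (k k' U : ℕ) :
    ((k : ℝ) + k' + 1) * ∑' x : ℤ, (x : ℝ) ^ 2 * rr k k' U x =
      (((k : ℝ) + 1) * U - k) * ∑' x : ℤ, (x : ℝ) * rr k k' U x + (k : ℝ) * U * TT k k' U := by
  have := rr_stein k k' U (fun x => (x : ℝ))
  have h2 : ∀ x : ℤ, ((x : ℝ) * ((x : ℝ) * ((U : ℝ) - x + k')) - ((x + 1 : ℤ) : ℝ) * (((x : ℝ) + k) * ((U : ℝ) - x))) * rr k k' U x
      = ((k : ℝ) + k' + 1) * ((x : ℝ) ^ 2 * rr k k' U x) - ((((k : ℝ) + 1) * U - k) * ((x : ℝ) * rr k k' U x) + (k : ℝ) * U * rr k k' U x) := by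
    intro x; push_cast; ring
  simp only [h2] at this
  rw [Summable.tsum_sub ((rr_summable _ _ _ _).mul_left _)
    (((rr_summable _ _ _ _).mul_left _).add ((rr_summable' _ _ _).mul_left _)),
    Summable.tsum_add ((rr_summable _ _ _ _).mul_left _) ((rr_summable' _ _ _).mul_left _),
    tsum_mul_left, tsum_mul_left, tsum_mul_left] at this
  unfold TT; linarith

lemma TT_nonneg (k k' U : ℕ) : 0 ≤ TT k k' U := tsum_nonneg (rr_nonneg _ _ _)

lemma rr_var (k k' U : ℕ) (hk : 1 ≤ k) (hk' : 1 ≤ k') (μ s2 : ℝ) (hμ : μ = k * U / ((k : ℝ) + k'))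
    (hs : s2 = U * ((U : ℝ) + ((k : ℝ) + k')) * k * k' / ((k : ℝ) + k') ^ 3) :
    ∑' x : ℤ, ((x : ℝ) - μ) ^ 2 * rr k k' U x ≤ s2 * TT k k' U := by
  have hK : (0 : ℝ) < (k : ℝ) + k' := by positivity
  have h2 : ∀ x : ℤ, ((x : ℝ) - μ) ^ 2 * rr k k' U x
      = (x : ℝ) ^ 2 * rr k k' U x + (-2 * μ) * ((x : ℝ) * rr k k' U x) + μ ^ 2 * rr k k' U x := by
    intro x; ring
  simp only [h2]
  rw [Summable.tsum_add ((rr_summable _ _ _ _).add ((rr_summable _ _ _ _).mul_left _)) ((rr_summable' _ _ _).mul_left _),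
    Summable.tsum_add (rr_summable _ _ _ _) ((rr_summable _ _ _ _).mul_left _), tsum_mul_left, tsum_mul_left]
  have hm := rr_mean k k' U
  have hs2 := rr_second k k' U
  set M1 := ∑' x : ℤ, (x : ℝ) * rr k k' U x
  set M2 := ∑' x : ℤ, (x : ℝ) ^ 2 * rr k k' U x
  have hT := TT_nonneg k k' U
  change M2 + -2 * μ * M1 + μ ^ 2 * TT k k' U ≤ _
  set T := TT k k' U
  have e1 : M1 = μ * T := by rw [hμ]; field_simp; linarith
  have e2 : M2 = ((((k : ℝ) + 1) * U - k) * (μ * T) + (k : ℝ) * U * T) / ((k : ℝ) + k' + 1) := by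
    rw [← e1]; field_simp; linarith
  have e3 : M2 + -2 * μ * M1 + μ ^ 2 * T = s2 * T * (((k : ℝ) + k') / ((k : ℝ) + k' + 1)) := by
    rw [e1, e2, hμ, hs]; field_simp; ring
  rw [e3]
  have hs0 : 0 ≤ s2 := by rw [hs]; positivity
  apply mul_le_of_le_one_right (by positivity)
  rw [div_le_one (by positivity)]; linarith

lemma TT_rec (k k' U : ℕ) : ((U : ℝ) + 1) * TT k k' (U + 1) = ((U : ℝ) + (k + k')) * TT k k' U := by
  have a1 : ∑' x : ℤ, (x : ℝ) * rr k k' (U + 1) x = ∑' x : ℤ, ((x : ℝ) + k) * rr k k' U x := by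
    rw [← (Equiv.addRight (1 : ℤ)).tsum_eq]
    apply tsum_congr
    intro x
    have h := cz_rec k x
    simp only [Equiv.coe_addRight, rr]
    have e : ((U + 1 : ℕ) : ℤ) - (x + 1) = U - x := by push_cast; ring
    rw [e]; push_cast
    linear_combination cz k' ((U : ℤ) - x) * h
  have a2 : ∑' x : ℤ, ((U : ℝ) + 1 - x) * rr k k' (U + 1) x = ∑' x : ℤ, ((U : ℝ) - x + k') * rr k k' U x := by
    apply tsum_congr
    intro x
    have h := cz_rec k' ((U : ℤ) - x)
    simp only [rr]
    have e : ((U + 1 : ℕ) : ℤ) - x = U - x + 1 := by push_cast; ring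
    rw [e]; push_cast at h ⊢
    linear_combination cz k x * h
  unfold TT
  rw [← tsum_mul_left, ← tsum_mul_left]
  calc _ = ∑' x : ℤ, ((x : ℝ) * rr k k' (U + 1) x + ((U : ℝ) + 1 - x) * rr k k' (U + 1) x) := by
        apply tsum_congr; intro x; ring
    _ = ∑' x : ℤ, (((x : ℝ) + k) * rr k k' U x + ((U : ℝ) - x + k') * rr k k' U x) := by
        rw [Summable.tsum_add (rr_summable _ _ _ _) (rr_summable _ _ _ _), a1, a2,
          Summable.tsum_add (rr_summable _ _ _ _) (rr_summable _ _ _ _)]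
    _ = _ := by apply tsum_congr; intro x; ring

lemma abs_log_one_add_sub {z : ℝ} (hz : |z| ≤ 1 / 2) : |Real.log (1 + z) - z| ≤ 2 * z ^ 2 := by
  have h1 : -(1/2) ≤ z ∧ z ≤ 1/2 := abs_le.mp hz
  have hpos : 0 < 1 + z := by linarith [h1.1]
  have hu := Real.log_le_sub_one_of_pos hpos
  have hl := Real.one_sub_inv_le_log_of_pos hpos
  have e : 1 - (1 + z)⁻¹ = z - z ^ 2 / (1 + z) := by field_simp; ring
  have h2 : z ^ 2 / (1 + z) ≤ 2 * z ^ 2 := by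
    rw [div_le_iff₀ hpos]
    nlinarith [mul_nonneg (sq_nonneg z) (by linarith [h1.1] : 0 ≤ 1 + 2 * z)]
  rw [abs_le]
  constructor <;> nlinarith [sq_nonneg z]

set_option maxHeartbeats 1000000 in
lemma window (k k' U : ℕ) (hk : 1 ≤ k) (hk' : 1 ≤ k') (hU : 1 ≤ U) (K μ B s κ R : ℝ)
    (hK : K = (k : ℝ) + k') (hμ : μ = k * U / K) (hB : B = k' * (U + K) / K)
    (hs : 0 < s) (hs2 : s ^ 2 = μ * B / K) (hκA : s ≤ κ * μ) (hκB : s ≤ κ * B)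
    (hκs : (K + U) / K ≤ κ * s) (hR : 1 ≤ R) (hκ : 0 < κ) (hκR : 16 * R * κ ≤ 1)
    (i : ℤ) (hi : |(i : ℝ) - μ| ≤ R * s) :
    0 < rr k k' U i ∧ 0 < rr k k' U (i + 1) ∧
      |Real.log (rr k k' U (i + 1)) - Real.log (rr k k' U i) + ((i : ℝ) - μ) / s ^ 2| ≤
        22 * R ^ 2 * κ / s := by
  have hkR : (1 : ℝ) ≤ k := by exact_mod_cast hk
  have hkR' : (1 : ℝ) ≤ k' := by exact_mod_cast hk'
  have hUR : (1 : ℝ) ≤ U := by exact_mod_cast hU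
  have hK0 : 0 < K := by rw [hK]; positivity
  have hμ0 : 0 < μ := by rw [hμ]; positivity
  have hB0 : 0 < B := by rw [hB]; positivity
  have h1s : 1 ≤ κ * s := by
    refine le_trans ?_ hκs
    rw [le_div_iff₀ hK0]; linarith
  have hκ1 : κ ≤ 1 := by nlinarith only [hκ, hR, hκR]
  have hμK : μ * K = k * U := by rw [hμ]; field_simp
  have hBK : B * K = k' * (U + K) := by rw [hB]; field_simp
  have hAB : U - μ + k' = B := by
    rw [hμ, hB, hK]; field_simp; ring
  set d : ℝ := (i : ℝ) - μ with hd
  have hdd := abs_le.mp hi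
  have h1 : |d + 1| ≤ 2 * R * s := by
    have : 1 ≤ R * s := by nlinarith only [hs, h1s, hκ1, hR]
    rw [abs_le]; constructor <;> linarith
  have hα : |(d + 1) / μ| ≤ 2 * R * κ := by
    rw [abs_div, abs_of_pos hμ0, div_le_iff₀ hμ0]
    calc _ ≤ 2 * R * s := h1
      _ ≤ 2 * R * (κ * μ) := by gcongr
      _ = _ := by ring
  have hβ : |(d + 1) / B| ≤ 2 * R * κ := by
    rw [abs_div, abs_of_pos hB0, div_le_iff₀ hB0]
    calc _ ≤ 2 * R * s := h1
      _ ≤ 2 * R * (κ * B) := by gcongr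
      _ = _ := by ring
  set α := (d + 1) / μ with hαd
  set β := (d + 1) / B with hβd
  have hα' := abs_le.mp hα
  have hβ' := abs_le.mp hβ
  have f1 : (i : ℝ) + 1 = μ * (1 + α) := by rw [hαd]; field_simp; rw [hd]; ring
  have f2 : (U : ℝ) - i - 1 + k' = B * (1 - β) := by
    rw [hβd]; field_simp; rw [hd]; linarith
  set η := 2 * R * κ with hη
  have hη0 : 0 < η := by positivity
  have hη8 : η ≤ 1 / 8 := by rw [hη]; linarith
  have hP : |(1 + α) * (1 - β) - 1| ≤ 3 * η := by
    have : |α * β| ≤ η * η := by rw [abs_mul]; gcongr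
    have := abs_le.mp this
    have e : (1 + α) * (1 - β) - 1 = α - β - α * β := by ring
    have hηη : η * η ≤ η := by nlinarith only [hη0, hη8]
    rw [abs_le, e]; constructor <;> linarith
  set P := (1 + α) * (1 - β) with hPd
  have hP' := abs_le.mp hP
  have hPh : 1 / 2 ≤ P := by linarith
  have hP0 : 0 < P := by linarith
  have f1p : 0 < (i : ℝ) + 1 := by rw [f1]; apply mul_pos hμ0; linarith
  have f2p : 0 < (U : ℝ) - i - 1 + k' := by rw [f2]; apply mul_pos hB0; linarith
  have hden : ((i : ℝ) + 1) * ((U : ℝ) - i - 1 + k') = s ^ 2 * K * P := by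
    rw [f1, f2, hs2, hPd]; field_simp
  have hi0 : 0 ≤ i := by
    have : (-1 : ℤ) < i := by
      have : (-1 : ℝ) < (i : ℝ) := by linarith
      exact_mod_cast this
    omega
  have hi0R : (0 : ℝ) ≤ i := by exact_mod_cast hi0
  set e0 : ℝ := -U + 2 * i + 1 - k' with he0
  have he0b : |e0| ≤ U + K := by
    rw [abs_le, he0, hK]; constructor <;> linarith
  set z : ℝ := (-K * d + e0) / (s ^ 2 * K * P) with hz
  have hnum : ((i : ℝ) + k) * ((U : ℝ) - i) = (s ^ 2 * K * P) * (1 + z) := by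
    have : (s ^ 2 * K * P) * (1 + z) = (s ^ 2 * K * P) + (-K * d + e0) := by
      rw [hz]; field_simp
    rw [this, ← hden, he0, hd]
    have : -K * ((i : ℝ) - μ) = -(k + k') * i + k * U := by rw [← hμK, hK]; ring
    rw [this]; ring
  have hPinv : |1 - 1 / P| ≤ 6 * η := by
    have : 1 - 1 / P = (P - 1) / P := by field_simp
    rw [this, abs_div, abs_of_pos hP0, div_le_iff₀ hP0]
    nlinarith only [hP, hPh, hη0]
  have hz1 : |z + d / s ^ 2| ≤ 14 * R ^ 2 * κ / s := by
    have e : z + d / s ^ 2 = d / s ^ 2 * (1 - 1 / P) + e0 / (s ^ 2 * K * P) := by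
      rw [hz]; field_simp; ring
    rw [e]
    have b1 : |d / s ^ 2 * (1 - 1 / P)| ≤ (R / s) * (6 * η) := by
      rw [abs_mul]
      have : |d / s ^ 2| ≤ R / s := by
        rw [abs_div, abs_of_pos (by positivity : 0 < s ^ 2), div_le_div_iff₀ (by positivity) hs]
        calc |d| * s ≤ R * s * s := by gcongr
          _ = _ := by ring
      gcongr
    have b2 : |e0 / (s ^ 2 * K * P)| ≤ 2 * κ / s := by
      rw [abs_div, abs_of_pos (by positivity : 0 < s ^ 2 * K * P), div_le_div_iff₀ (by positivity) hs]
      have : U + K ≤ κ * s * K := by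
        rw [div_le_iff₀ hK0] at hκs; linarith
      calc |e0| * s ≤ (κ * s * K) * s := by gcongr; linarith
        _ = (κ * s ^ 2 * K) * 1 := by ring
        _ ≤ (κ * s ^ 2 * K) * (2 * P) := by gcongr; linarith
        _ = _ := by ring
    calc _ ≤ _ := abs_add_le _ _
      _ ≤ (R / s) * (6 * η) + 2 * κ / s := add_le_add b1 b2
      _ = (12 * R ^ 2 * κ + 2 * κ) / s := by rw [hη]; ring
      _ ≤ _ := by gcongr; nlinarith only [mul_nonneg hκ.le (by nlinarith only [hR] : 0 ≤ R ^ 2 - 1)]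
  have hz2 : |z| ≤ 2 * R / s := by
    have : |d / s ^ 2| ≤ R / s := by
      rw [abs_div, abs_of_pos (by positivity : 0 < s ^ 2), div_le_div_iff₀ (by positivity) hs]
      calc |d| * s ≤ R * s * s := by gcongr
        _ = _ := by ring
    have h3 : 14 * R ^ 2 * κ / s ≤ R / s := by gcongr; nlinarith only [hR, hκ, hκR]
    have : |z| ≤ |z + d / s ^ 2| + |d / s ^ 2| := by
      calc |z| = |(z + d / s ^ 2) - d / s ^ 2| := by ring_nf
        _ ≤ _ := abs_sub _ _
    calc _ ≤ R / s + R / s := by linarith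
      _ = _ := by ring
  have hs1 : 1 / s ≤ κ := by rw [div_le_iff₀ hs]; exact h1s
  have hz3 : |z| ≤ 1 / 2 := by
    have : 2 * R / s = 2 * R * (1 / s) := by ring
    have : 2 * R * (1 / s) ≤ 2 * R * κ := by gcongr
    linarith
  have hlog := abs_log_one_add_sub hz3
  have hz4 : z ^ 2 ≤ 4 * R ^ 2 * κ / s := by
    calc z ^ 2 = |z| ^ 2 := (sq_abs z).symm
      _ ≤ (2 * R / s) ^ 2 := by gcongr
      _ = 4 * R ^ 2 * (1 / s) / s := by field_simp; ring
      _ ≤ _ := by gcongr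
  have h1z : 0 < 1 + z := by linarith [(abs_le.mp hz3).1]
  have hnum0 : 0 < ((i : ℝ) + k) * ((U : ℝ) - i) := by rw [hnum]; positivity
  have hUi : 0 < (U : ℝ) - i := by
    by_contra h
    push Not at h
    have := mul_nonpos_of_nonneg_of_nonpos (by linarith : 0 ≤ (i : ℝ) + k) h
    linarith
  have hUi' : i < U := by
    have : (i : ℝ) < U := by linarith
    exact_mod_cast this
  have r0 : 0 < rr k k' U i := mul_pos (cz_pos hk hi0) (cz_pos hk' (by omega))
  have r1 : 0 < rr k k' U (i + 1) := mul_pos (cz_pos hk (by omega)) (cz_pos hk' (by omega))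
  refine ⟨r0, r1, ?_⟩
  have hrec := rr_rec k k' U i
  rw [hden, hnum] at hrec
  have hratio : rr k k' U (i + 1) = rr k k' U i * (1 + z) := by
    have : (s ^ 2 * K * P) ≠ 0 := by positivity
    apply mul_right_cancel₀ this
    rw [hrec]; ring
  rw [hratio, Real.log_mul r0.ne' h1z.ne']
  calc _ = |(Real.log (1 + z) - z) + (z + d / s ^ 2)| := by congr 1; ring
    _ ≤ 2 * z ^ 2 + 14 * R ^ 2 * κ / s := (abs_add_le _ _).trans (add_le_add hlog hz1)
    _ ≤ 2 * (4 * R ^ 2 * κ / s) + 14 * R ^ 2 * κ / s := by gcongr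
    _ = _ := by ring

lemma G_lip (G : ℤ → ℝ) (μ W c : ℝ) (h : ∀ i : ℤ, |(i : ℝ) - μ| ≤ W → |G (i + 1) - G i| ≤ c)
    (n : ℕ) : ∀ x : ℤ, |(x : ℝ) - μ| ≤ W → |((x + n : ℤ) : ℝ) - μ| ≤ W → |G (x + n) - G x| ≤ n * c := by
  induction n with
  | zero => intro x _ _; simp
  | succ n ih =>
    intro x h1 h2
    have h3 : |((x + n : ℤ) : ℝ) - μ| ≤ W := by
      rw [abs_le] at h1 h2 ⊢
      push_cast at h2 ⊢
      have : (0 : ℝ) ≤ n := by positivity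
      constructor <;> linarith [h1.1, h2.2]
    have := ih x h1 h3
    have h4 := h _ h3
    have e : (x + ((n + 1 : ℕ) : ℤ)) = x + n + 1 := by push_cast; ring
    rw [e]
    push_cast
    calc _ = |(G (x + n + 1) - G (x + n)) + (G (x + n) - G x)| := by congr 1; ring
      _ ≤ _ := abs_add_le _ _
      _ ≤ _ := by linarith

lemma G_lip' (G : ℤ → ℝ) (μ W c : ℝ) (h : ∀ i : ℤ, |(i : ℝ) - μ| ≤ W → |G (i + 1) - G i| ≤ c)
    (hc : 0 ≤ c) (x y : ℤ) (hx : |(x : ℝ) - μ| ≤ W) (hy : |(y : ℝ) - μ| ≤ W) :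
    |G y - G x| ≤ 2 * W * c := by
  wlog hxy : x ≤ y generalizing x y
  · rw [abs_sub_comm]; exact this y x hy hx (by omega)
  obtain ⟨n, hn⟩ := Int.eq_ofNat_of_zero_le (sub_nonneg.mpr hxy)
  obtain rfl : y = x + n := by omega
  refine (G_lip G μ W c h n x hx hy).trans ?_
  gcongr
  rw [abs_le] at hx hy
  push_cast at hy
  linarith [hx.1, hy.2]

set_option maxHeartbeats 1000000 in
lemma tv_window (k k' U : ℕ) (hk : 1 ≤ k) (hk' : 1 ≤ k') (hU : 1 ≤ U) (K μ B s κ R M : ℝ)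
    (hK : K = (k : ℝ) + k') (hμ : μ = k * U / K) (hB : B = k' * (U + K) / K)
    (hs : 0 < s) (hs2 : s ^ 2 = μ * B / K) (hκA : s ≤ κ * μ) (hκB : s ≤ κ * B)
    (hκs : (K + U) / K ≤ κ * s) (hR : 1 < R) (hκ : 0 < κ) (hκR : 16 * R * κ ≤ 1)
    (hM : 0 ≤ M) (hMκ : M * κ ≤ 1) (hθ : (46 * R ^ 3 + M * R) * κ ≤ 1)
    (C : ℤ) (hC : |(C : ℝ) - 2 * μ| ≤ M * κ * s) :
    ∑' x : ℤ, |rr k k' U x - rr k k' U (C - x)| ≤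
      (2 * ((46 * R ^ 3 + M * R) * κ) + 2 / (R - 1) ^ 2) * TT k k' U := by
  have hK0 : 0 < K := by rw [hK]; positivity
  have hwin := window k k' U hk hk' hU K μ B s κ R hK hμ hB hs hs2 hκA hκB hκs hR.le hκ hκR
  have h1s : 1 ≤ κ * s := by
    refine le_trans ?_ hκs
    rw [le_div_iff₀ hK0]
    have : (0 : ℝ) ≤ U := by positivity
    linarith
  have hs1 : 1 / s ≤ κ := by rw [div_le_iff₀ hs]; exact h1s
  set r := rr k k' U with hr
  set θ := (46 * R ^ 3 + M * R) * κ with hθd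
  have hθ0 : 0 ≤ θ := by positivity
  set G : ℤ → ℝ := fun i => Real.log (r i) + ((i : ℝ) - μ) ^ 2 / (2 * s ^ 2) with hG
  have hGstep : ∀ i : ℤ, |(i : ℝ) - μ| ≤ R * s → |G (i + 1) - G i| ≤ 23 * R ^ 2 * κ / s := by
    intro i hi
    obtain ⟨_, _, h3⟩ := hwin i hi
    have e : G (i + 1) - G i = (Real.log (r (i + 1)) - Real.log (r i) + ((i : ℝ) - μ) / s ^ 2) + 1 / (2 * s ^ 2) := by
      simp only [hG]; push_cast; field_simp; ring
    rw [e]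
    have h4 : |1 / (2 * s ^ 2)| ≤ R ^ 2 * κ / s := by
      rw [abs_of_pos (by positivity)]
      calc 1 / (2 * s ^ 2) = (1 / s) * (1 / 2) / s := by field_simp
        _ ≤ κ * 1 / s := by gcongr; norm_num
        _ ≤ κ * R ^ 2 / s := by gcongr; exact one_le_pow₀ hR.le
        _ = _ := by ring
    calc _ ≤ _ := abs_add_le _ _
      _ ≤ 22 * R ^ 2 * κ / s + R ^ 2 * κ / s := add_le_add h3 h4
      _ = _ := by ring
  have hGl := G_lip' G μ (R * s) (23 * R ^ 2 * κ / s) hGstep (by positivity)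
  have hin : ∀ x : ℤ, |(x : ℝ) - μ| ≤ R * s → |((C - x : ℤ) : ℝ) - μ| ≤ R * s →
      |r x - r (C - x)| ≤ 2 * θ * r x := by
    intro x hx hx'
    have p1 := (hwin x hx).1
    have p2 := (hwin _ hx').1
    have hg := hGl x (C - x) hx hx'
    have hL : |Real.log (r (C - x)) - Real.log (r x)| ≤ θ := by
      have e : Real.log (r (C - x)) - Real.log (r x) =
          (G (C - x) - G x) + (-((C : ℝ) - 2 * μ) * (C - 2 * x) / (2 * s ^ 2)) := by
        simp only [hG]; push_cast; field_simp; ring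
      rw [e]
      have b : |-((C : ℝ) - 2 * μ) * (C - 2 * x) / (2 * s ^ 2)| ≤ M * R * κ := by
        rw [abs_div, abs_mul, abs_neg, abs_of_pos (by positivity : 0 < 2 * s ^ 2), div_le_iff₀ (by positivity)]
        have : |(C : ℝ) - 2 * x| ≤ 2 * (R * s) := by
          rw [abs_le] at hx hx' ⊢
          push_cast at hx'
          constructor <;> linarith [hx.1, hx.2, hx'.1, hx'.2]
        calc _ ≤ (M * κ * s) * (2 * (R * s)) := by gcongr
          _ = _ := by ring
      calc _ ≤ _ := abs_add_le _ _
        _ ≤ 2 * (R * s) * (23 * R ^ 2 * κ / s) + M * R * κ := add_le_add hg b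
        _ = θ := by rw [hθd]; field_simp; ring
    have hexp := Real.abs_exp_sub_one_le (hL.trans hθ)
    have e : r (C - x) = r x * Real.exp (Real.log (r (C - x)) - Real.log (r x)) := by
      rw [Real.exp_sub, Real.exp_log p1, Real.exp_log p2]; field_simp
    have e2 : r x - r (C - x) = - (r x * (Real.exp (Real.log (r (C - x)) - Real.log (r x)) - 1)) := by
      rw [mul_sub, ← e]; ring
    rw [e2, abs_neg, abs_mul, abs_of_pos p1]
    calc _ ≤ r x * (2 * θ) := by gcongr; linarith
      _ = _ := by ring
  have hR1 : 0 < R - 1 := by linarith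
  have hCs : |(C : ℝ) - 2 * μ| ≤ s := hC.trans (by
    have := mul_le_mul_of_nonneg_right hMκ hs.le
    linarith)
  set V := (R - 1) ^ 2 * s ^ 2 with hV
  have hV0 : 0 < V := by positivity
  have hpt : ∀ x : ℤ, |r x - r (C - x)| ≤ 2 * θ * r x +
      (((x : ℝ) - μ) ^ 2 / V * r x + (((C - x : ℤ) : ℝ) - μ) ^ 2 / V * r (C - x)) := by
    intro x
    have n1 : 0 ≤ r x := rr_nonneg _ _ _ _
    have n2 : 0 ≤ r (C - x) := rr_nonneg _ _ _ _
    by_cases hb : |(x : ℝ) - μ| ≤ R * s ∧ |((C - x : ℤ) : ℝ) - μ| ≤ R * s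
    · have := hin x hb.1 hb.2
      have : 0 ≤ (((x : ℝ) - μ) ^ 2 / V * r x + (((C - x : ℤ) : ℝ) - μ) ^ 2 / V * r (C - x)) := by positivity
      linarith
    · have hfar : (R - 1) * s ≤ |(x : ℝ) - μ| ∧ (R - 1) * s ≤ |((C - x : ℤ) : ℝ) - μ| := by
        have hs' : |(C : ℝ) - 2 * μ| = |((x : ℝ) - μ) + (((C - x : ℤ) : ℝ) - μ)| := by
          push_cast; congr 1; ring
        have t1 : |((C - x : ℤ) : ℝ) - μ| ≤ |(x : ℝ) - μ| + s := by
          calc |((C - x : ℤ) : ℝ) - μ| = |(((x : ℝ) - μ) + (((C - x : ℤ) : ℝ) - μ)) - ((x : ℝ) - μ)| := by congr 1; ring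
            _ ≤ _ := abs_sub _ _
            _ ≤ _ := by rw [← hs']; linarith
        have t2 : |(x : ℝ) - μ| ≤ |((C - x : ℤ) : ℝ) - μ| + s := by
          calc |(x : ℝ) - μ| = |(((x : ℝ) - μ) + (((C - x : ℤ) : ℝ) - μ)) - (((C - x : ℤ) : ℝ) - μ)| := by congr 1; ring
            _ ≤ _ := abs_sub _ _
            _ ≤ _ := by rw [← hs']; linarith
        rw [not_and_or, not_le, not_le] at hb
        have e3 : (R - 1) * s = R * s - s := by ring
        rw [e3]
        rcases hb with hb | hb <;> constructor <;> linarith only [hb, t1, t2, hs]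
      have q1 : 1 ≤ ((x : ℝ) - μ) ^ 2 / V := by
        rw [le_div_iff₀ hV0, one_mul, hV, ← sq_abs ((x : ℝ) - μ), ← mul_pow]
        exact pow_le_pow_left₀ (by positivity) hfar.1 2
      have q2 : 1 ≤ (((C - x : ℤ) : ℝ) - μ) ^ 2 / V := by
        rw [le_div_iff₀ hV0, one_mul, hV, ← sq_abs (((C - x : ℤ) : ℝ) - μ), ← mul_pow]
        exact pow_le_pow_left₀ (by positivity) hfar.2 2
      have : |r x - r (C - x)| ≤ r x + r (C - x) := by
        rw [abs_le]; constructor <;> linarith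
      have w1 := mul_le_mul_of_nonneg_right q1 n1
      have w2 := mul_le_mul_of_nonneg_right q2 n2
      have : 0 ≤ 2 * θ * r x := by positivity
      linarith
  have hsm : Summable (fun x : ℤ => ((x : ℝ) - μ) ^ 2 / V * r x) := rr_summable k k' U _
  have hsm2 : Summable (fun x : ℤ => (((C - x : ℤ) : ℝ) - μ) ^ 2 / V * r (C - x)) :=
    hsm.comp_injective (i := fun x : ℤ => C - x) (fun a b h => by simpa using h)
  have heq : ∑' x : ℤ, (((C - x : ℤ) : ℝ) - μ) ^ 2 / V * r (C - x) = ∑' x : ℤ, ((x : ℝ) - μ) ^ 2 / V * r x :=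
    (Equiv.subLeft C).tsum_eq (fun x : ℤ => ((x : ℝ) - μ) ^ 2 / V * r x)
  have hr1 : Summable r := rr_summable' _ _ _
  have hr2 : Summable (fun x => r (C - x)) := hr1.comp_injective (i := fun x : ℤ => C - x) (fun a b h => by simpa using h)
  have hvar := rr_var k k' U hk hk' μ (s ^ 2) (by rw [hμ, hK]) (by
    rw [hs2, hμ, hB, hK]; field_simp)
  have hv2 : ∑' x : ℤ, ((x : ℝ) - μ) ^ 2 / V * r x ≤ 1 / (R - 1) ^ 2 * TT k k' U := by
    have : ∑' x : ℤ, ((x : ℝ) - μ) ^ 2 / V * r x = (1 / V) * ∑' x : ℤ, ((x : ℝ) - μ) ^ 2 * r x := by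
      rw [← tsum_mul_left]; apply tsum_congr; intro x; ring
    rw [this]
    calc _ ≤ (1 / V) * (s ^ 2 * TT k k' U) := by gcongr
      _ = _ := by rw [hV]; field_simp
  have hbig := (hr1.mul_left (2 * θ)).add (hsm.add hsm2)
  calc _ ≤ ∑' x : ℤ, (2 * θ * r x +
      (((x : ℝ) - μ) ^ 2 / V * r x + (((C - x : ℤ) : ℝ) - μ) ^ 2 / V * r (C - x))) :=
        Summable.tsum_le_tsum hpt ((hr1.sub hr2).abs) hbig
    _ = 2 * θ * TT k k' U + (∑' x : ℤ, ((x : ℝ) - μ) ^ 2 / V * r x + ∑' x : ℤ, ((x : ℝ) - μ) ^ 2 / V * r x) := by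
        rw [Summable.tsum_add (hr1.mul_left _) (hsm.add hsm2), Summable.tsum_add hsm hsm2, heq, tsum_mul_left, hr, TT]
    _ ≤ 2 * θ * TT k k' U + (1 / (R - 1) ^ 2 * TT k k' U + 1 / (R - 1) ^ 2 * TT k k' U) := by gcongr
    _ = _ := by ring

lemma tv_small (ε c M : ℝ) (hε : 0 < ε) (hc : 0 < c) (hM : 0 ≤ M) :
    ∃ m : ℕ, 1 ≤ m ∧ ∀ k k' U : ℕ, m ≤ k → m ≤ k' → 1 ≤ U → c * ((k : ℝ) + k') ≤ U → ∀ C : ℤ,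
      |(C : ℝ) - 2 * (k * U / ((k : ℝ) + k'))| ≤ M * (((k : ℝ) + k' + U) / ((k : ℝ) + k')) →
      ∑' x : ℤ, |rr k k' U x - rr k k' U (C - x)| ≤ ε * TT k k' U := by
  obtain ⟨R, hR, hRε⟩ : ∃ R : ℝ, 1 < R ∧ 2 / (R - 1) ^ 2 ≤ ε / 2 := by
    refine ⟨1 + (1 + 4 / ε), by have : 0 < 4 / ε := by positivity
                                linarith, ?_⟩
    have h4 : 0 < 4 / ε := by positivity
    have : 4 / ε ≤ (1 + (1 + 4 / ε) - 1) ^ 2 := by nlinarith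
    rw [div_le_iff₀ (lt_of_lt_of_le h4 this)]
    calc (2 : ℝ) = ε / 2 * (4 / ε) := by field_simp; norm_num
      _ ≤ _ := by gcongr
  set Q := 46 * R ^ 3 + M * R with hQ
  have hR0 : 0 < R := by linarith
  have hQ0 : 0 < Q := by positivity
  obtain ⟨κ, hκ, hκR, hMκ, hθ, hθε⟩ : ∃ κ : ℝ, 0 < κ ∧ 16 * R * κ ≤ 1 ∧ M * κ ≤ 1 ∧ Q * κ ≤ 1 ∧ 2 * (Q * κ) ≤ ε / 2 := by
    refine ⟨min (1 / (16 * R)) (min (1 / (M + 1)) (min (1 / Q) (ε / (4 * Q)))), by positivity, ?_, ?_, ?_, ?_⟩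
    · calc _ ≤ 16 * R * (1 / (16 * R)) := by gcongr; exact min_le_left _ _
        _ = 1 := by field_simp
    · calc _ ≤ M * (1 / (M + 1)) := by
            gcongr; exact (min_le_right _ _).trans (min_le_left _ _)
        _ ≤ 1 := by rw [mul_one_div, div_le_one (by positivity)]; linarith
    · calc _ ≤ Q * (1 / Q) := by
            gcongr; exact (min_le_right _ _).trans ((min_le_right _ _).trans (min_le_left _ _))
        _ = 1 := by field_simp
    · calc _ ≤ 2 * (Q * (ε / (4 * Q))) := by
            gcongr; exact (min_le_right _ _).trans ((min_le_right _ _).trans (min_le_right _ _))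
        _ = _ := by field_simp; norm_num
  obtain ⟨m, hm⟩ := exists_nat_ge (2 * (1 + 1 / c) / κ ^ 2)
  refine ⟨m + 1, by omega, ?_⟩
  intro k k' U hk hk' hU hcU C hC
  have hm0 : (0 : ℝ) ≤ m := by positivity
  have hkm : (m : ℝ) ≤ k := by exact_mod_cast (by omega : m ≤ k)
  have hkm' : (m : ℝ) ≤ k' := by exact_mod_cast (by omega : m ≤ k')
  have hk1 : (1 : ℝ) ≤ k := by exact_mod_cast (by omega : 1 ≤ k)
  have hk1' : (1 : ℝ) ≤ k' := by exact_mod_cast (by omega : 1 ≤ k')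
  have hU1 : (1 : ℝ) ≤ U := by exact_mod_cast hU
  set K : ℝ := (k : ℝ) + k' with hK
  have hK0 : 0 < K := by positivity
  set μ : ℝ := k * U / K with hμ
  set B : ℝ := k' * (U + K) / K with hB
  have hμ0 : 0 < μ := by positivity
  have hB0 : 0 < B := by positivity
  set s := Real.sqrt (μ * B / K) with hs
  have hs0 : 0 < s := Real.sqrt_pos.mpr (by positivity)
  have hs2 : s ^ 2 = μ * B / K := Real.sq_sqrt (by positivity)
  have hUK : (U + K) / U ≤ 1 + 1 / c := by
    rw [div_le_iff₀ (by positivity)]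
    have : K ≤ 1 / c * U := by rw [one_div, ← div_eq_inv_mul, le_div_iff₀ hc]; linarith
    linarith
  have hkey : 2 * (1 + 1 / c) ≤ κ ^ 2 * m := by
    rw [div_le_iff₀ (by positivity)] at hm; linarith
  have hc1 : 0 < 1 / c := by positivity
  have hA : s ≤ κ * μ := by
    apply le_of_sq_le_sq _ (by positivity)
    rw [hs2, mul_pow]
    have : B / K ≤ κ ^ 2 * μ := by
      have e : B / K = (k' / K) * ((U + K) / U) * (U / K) := by rw [hB]; field_simp
      have hk'K : (k' : ℝ) / K ≤ 1 := by rw [div_le_one hK0]; linarith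
      rw [e, hμ]
      calc _ ≤ 1 * (1 + 1 / c) * (U / K) := by gcongr
        _ ≤ (κ ^ 2 * k) * (U / K) := by
            have : κ ^ 2 * m ≤ κ ^ 2 * k := by gcongr
            apply mul_le_mul_of_nonneg_right _ (by positivity)
            linarith
        _ = _ := by ring
    calc _ = μ * (B / K) := by ring
      _ ≤ μ * (κ ^ 2 * μ) := by gcongr
      _ = _ := by ring
  have hBs : s ≤ κ * B := by
    apply le_of_sq_le_sq _ (by positivity)
    rw [hs2, mul_pow]
    have : μ / K ≤ κ ^ 2 * B := by
      have e : μ / K = (k / K) * (U / K) := by rw [hμ]; field_simp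
      have hkK : (k : ℝ) / K ≤ 1 := by rw [div_le_one hK0]; linarith
      rw [e, hB]
      calc _ ≤ 1 * (U / K) := by gcongr
        _ ≤ (κ ^ 2 * k') * ((U + K) / K) := by
            have : κ ^ 2 * m ≤ κ ^ 2 * k' := by gcongr
            apply mul_le_mul (by linarith) (by gcongr; linarith) (by positivity) (by positivity)
        _ = _ := by ring
    calc _ = B * (μ / K) := by ring
      _ ≤ B * (κ ^ 2 * B) := by gcongr
      _ = _ := by ring
  have hKs : (K + U) / K ≤ κ * s := by
    apply le_of_sq_le_sq _ (by positivity)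
    rw [mul_pow, hs2]
    have h2 : (1 + 1 / c) * K ≤ κ ^ 2 * (k * k') := by
      have a1 : κ ^ 2 * m ≤ κ ^ 2 * k := by gcongr
      have a2 : κ ^ 2 * m ≤ κ ^ 2 * k' := by gcongr
      have b1 : 2 * (1 + 1 / c) * k' ≤ κ ^ 2 * k * k' := mul_le_mul_of_nonneg_right (by linarith) (by positivity)
      have b2 : 2 * (1 + 1 / c) * k ≤ κ ^ 2 * k' * k := mul_le_mul_of_nonneg_right (by linarith) (by positivity)
      rw [hK]; linarith
    have h3 : (U + K) / U * K ≤ κ ^ 2 * (k * k') := le_trans (by gcongr) h2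
    calc ((K + U) / K) ^ 2 = ((U + K) / U * K) * (U * (U + K) / K ^ 3) := by field_simp; ring
      _ ≤ (κ ^ 2 * (k * k')) * (U * (U + K) / K ^ 3) := by gcongr
      _ = _ := by rw [hμ, hB]; field_simp
  have hC' : |(C : ℝ) - 2 * μ| ≤ M * κ * s := by
    refine hC.trans ?_
    rw [mul_assoc]; gcongr
  have := tv_window k k' U (by omega) (by omega) hU K μ B s κ R M rfl rfl rfl hs0 hs2 hA hBs hKs hR hκ hκR hM hMκ hθ C hC'
  refine this.trans ?_
  apply mul_le_mul_of_nonneg_right _ (TT_nonneg _ _ _)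
  linarith

lemma prod_reflect (r1 r2 : ℤ → ℝ) (h1 : ∀ x, 0 ≤ r1 x) (h2 : ∀ x, 0 ≤ r2 x)
    (s1 : Summable r1) (s2 : Summable r2) (C C' : ℤ) (ε : ℝ) (a : ℝ)
    (t1 : ∑' x, |r1 x - r1 (C - x)| ≤ ε * ∑' x, r1 x)
    (t2 : ∑' x, |r2 x - r2 (C' - x)| ≤ ε * ∑' x, r2 x)
    (ha : 2 * a ≤ (C : ℝ) - C') :
    (∑' x, r1 x) * (∑' x, r2 x) ≤
      2 * (∑' p : ℤ × ℤ, if a ≤ (p.1 : ℝ) - p.2 then r1 p.1 * r2 p.2 else 0) +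
        2 * ε * ((∑' x, r1 x) * (∑' x, r2 x)) := by
  classical
  have inj : ∀ c : ℤ, Function.Injective (fun x : ℤ => c - x) := fun c a b h => by simpa using h
  have s1' : Summable (fun x => r1 (C - x)) := s1.comp_injective (inj C)
  have s2' : Summable (fun x => r2 (C' - x)) := s2.comp_injective (inj C')
  have e1' : ∑' x, r1 (C - x) = ∑' x, r1 x := (Equiv.subLeft C).tsum_eq r1
  have e2' : ∑' x, r2 (C' - x) = ∑' x, r2 x := (Equiv.subLeft C').tsum_eq r2
  have sd1 : Summable (fun x => |r1 x - r1 (C - x)|) := (s1.sub s1').abs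
  have sd2 : Summable (fun x => |r2 x - r2 (C' - x)|) := (s2.sub s2').abs
  set T1 := ∑' x, r1 x with hT1
  set T2 := ∑' x, r2 x with hT2
  have hT1n : 0 ≤ T1 := tsum_nonneg h1
  have hT2n : 0 ≤ T2 := tsum_nonneg h2
  have sp : Summable (fun p : ℤ × ℤ => r1 p.1 * r2 p.2) := s1.mul_of_nonneg s2 h1 h2
  have sA : Summable (fun p : ℤ × ℤ => |r1 p.1 - r1 (C - p.1)| * r2 p.2) :=
    sd1.mul_of_nonneg s2 (fun _ => abs_nonneg _) h2
  have sB : Summable (fun p : ℤ × ℤ => r1 (C - p.1) * |r2 p.2 - r2 (C' - p.2)|) :=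
    s1'.mul_of_nonneg sd2 (fun _ => h1 _) (fun _ => abs_nonneg _)
  have sp' : Summable (fun p : ℤ × ℤ => r1 (C - p.1) * r2 (C' - p.2)) :=
    s1'.mul_of_nonneg s2' (fun _ => h1 _) (fun _ => h2 _)
  have eT : ∑' p : ℤ × ℤ, r1 p.1 * r2 p.2 = T1 * T2 := (s1.tsum_mul_tsum s2 sp).symm
  have eA : ∑' p : ℤ × ℤ, |r1 p.1 - r1 (C - p.1)| * r2 p.2 ≤ ε * (T1 * T2) := by
    rw [← sd1.tsum_mul_tsum s2 sA]
    calc _ ≤ (ε * T1) * T2 := by gcongr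
      _ = _ := by ring
  have eB : ∑' p : ℤ × ℤ, r1 (C - p.1) * |r2 p.2 - r2 (C' - p.2)| ≤ ε * (T1 * T2) := by
    rw [← s1'.tsum_mul_tsum sd2 sB, e1']
    calc _ ≤ T1 * (ε * T2) := by gcongr
      _ = _ := by ring
  set J : ℤ × ℤ → ℝ := fun p => if a ≤ (p.1 : ℝ) - p.2 then 1 else 0 with hJ
  have hJ0 : ∀ p, 0 ≤ J p := fun p => by simp only [hJ]; split_ifs <;> norm_num
  have hJ1 : ∀ p, J p ≤ 1 := fun p => by simp only [hJ]; split_ifs <;> norm_num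
  have hJJ : ∀ p : ℤ × ℤ, 1 ≤ J p + J (C - p.1, C' - p.2) := by
    intro p
    simp only [hJ]
    by_cases h : a ≤ (p.1 : ℝ) - p.2
    · rw [if_pos h]; split_ifs <;> norm_num
    · rw [if_neg h, if_pos (by push_cast; linarith)]; norm_num
  have eN : (∑' p : ℤ × ℤ, if a ≤ (p.1 : ℝ) - p.2 then r1 p.1 * r2 p.2 else 0) = ∑' p, J p * (r1 p.1 * r2 p.2) := by
    apply tsum_congr; intro p; simp only [hJ]; split_ifs <;> simp
  rw [eN]
  have sJ : Summable (fun p : ℤ × ℤ => J p * (r1 p.1 * r2 p.2)) :=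
    Summable.of_nonneg_of_le (fun p => mul_nonneg (hJ0 p) (mul_nonneg (h1 _) (h2 _)))
      (fun p => mul_le_of_le_one_left (mul_nonneg (h1 _) (h2 _)) (hJ1 p)) sp
  have sJ' : Summable (fun p : ℤ × ℤ => J p * (r1 (C - p.1) * r2 (C' - p.2))) :=
    Summable.of_nonneg_of_le (fun p => mul_nonneg (hJ0 p) (mul_nonneg (h1 _) (h2 _)))
      (fun p => mul_le_of_le_one_left (mul_nonneg (h1 _) (h2 _)) (hJ1 p)) sp'
  have sJ2 : Summable (fun p : ℤ × ℤ => J (C - p.1, C' - p.2) * (r1 p.1 * r2 p.2)) :=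
    Summable.of_nonneg_of_le (fun p => mul_nonneg (hJ0 _) (mul_nonneg (h1 _) (h2 _)))
      (fun p => mul_le_of_le_one_left (mul_nonneg (h1 _) (h2 _)) (hJ1 _)) sp
  have refl : ∑' p : ℤ × ℤ, J (C - p.1, C' - p.2) * (r1 p.1 * r2 p.2) =
      ∑' p : ℤ × ℤ, J p * (r1 (C - p.1) * r2 (C' - p.2)) := by
    rw [← (Equiv.prodCongr (Equiv.subLeft C) (Equiv.subLeft C')).tsum_eq]
    apply tsum_congr; rintro ⟨x, y⟩; simp
  have b1 : T1 * T2 ≤ ∑' p, J p * (r1 p.1 * r2 p.2) + ∑' p : ℤ × ℤ, J (C - p.1, C' - p.2) * (r1 p.1 * r2 p.2) := by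
    rw [← eT, ← sJ.tsum_add sJ2]
    refine sp.tsum_le_tsum (fun p => ?_) (sJ.add sJ2)
    rw [← add_mul]
    exact le_mul_of_one_le_left (mul_nonneg (h1 _) (h2 _)) (hJJ p)
  have b2 : ∑' p : ℤ × ℤ, J p * (r1 (C - p.1) * r2 (C' - p.2)) ≤
      ∑' p, J p * (r1 p.1 * r2 p.2) + (ε * (T1 * T2) + ε * (T1 * T2)) := by
    calc _ ≤ ∑' p : ℤ × ℤ, (J p * (r1 p.1 * r2 p.2) +
        (|r1 p.1 - r1 (C - p.1)| * r2 p.2 + r1 (C - p.1) * |r2 p.2 - r2 (C' - p.2)|)) := by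
          refine sJ'.tsum_le_tsum (fun p => ?_) (sJ.add (sA.add sB))
          have k1 : r1 (C - p.1) * r2 (C' - p.2) - r1 p.1 * r2 p.2 ≤
            (|r1 p.1 - r1 (C - p.1)| * r2 p.2 + r1 (C - p.1) * |r2 p.2 - r2 (C' - p.2)|) := by
            have i1 := mul_le_mul_of_nonneg_right (neg_abs_le (r1 p.1 - r1 (C - p.1))) (h2 p.2)
            have i2 := mul_le_mul_of_nonneg_left (neg_abs_le (r2 p.2 - r2 (C' - p.2))) (h1 (C - p.1))
            linarith
          have k2 : 0 ≤ (|r1 p.1 - r1 (C - p.1)| * r2 p.2 + r1 (C - p.1) * |r2 p.2 - r2 (C' - p.2)|) := by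
            have := h1 (C - p.1); have := h2 p.2; positivity
          have k3 := mul_le_mul_of_nonneg_left k1 (hJ0 p)
          have k4 := mul_le_of_le_one_left k2 (hJ1 p)
          linarith
      _ = ∑' p, J p * (r1 p.1 * r2 p.2) + (∑' p : ℤ × ℤ, |r1 p.1 - r1 (C - p.1)| * r2 p.2 +
           ∑' p : ℤ × ℤ, r1 (C - p.1) * |r2 p.2 - r2 (C' - p.2)|) := by
          rw [sJ.tsum_add (sA.add sB), sA.tsum_add sB]
      _ ≤ _ := by gcongr
  rw [refl] at b1
  linarith

lemma good_d (q M ε : ℝ) (hq : 0 < q) (hM : 0 ≤ M) (hε : 0 < ε) :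
    ∃ m : ℕ, 1 ≤ m ∧ ∀ k k' l l' : ℕ, m ≤ k → m ≤ k' → m ≤ l → m ≤ l' → ∀ τ : ℝ,
      |(k : ℝ) - τ * (k + k')| ≤ M → |(l : ℝ) - τ * (l + l')| ≤ M →
      (k : ℝ) + k' ≤ l + l' + M → ∀ (σ d : ℕ) (a : ℝ), |a - τ * σ| ≤ 1 →
      q / 8 * ((l : ℝ) + l') ≤ d →
      TT k k' (σ + d) * TT l l' d ≤
        2 * (∑' p : ℤ × ℤ, if a ≤ (p.1 : ℝ) - p.2 then rr k k' (σ + d) p.1 * rr l l' d p.2 else 0) +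
        ε * (TT k k' (σ + d) * TT l l' d) := by
  obtain ⟨m1, hm1, H1⟩ := tv_small (ε / 2) (q / 16) (4 + 6 * M) (by positivity) (by positivity) (by positivity)
  obtain ⟨m2, hm2, H2⟩ := tv_small (ε / 2) (q / 8) 1 (by positivity) (by positivity) (by positivity)
  obtain ⟨m3, hm3⟩ := exists_nat_ge M
  refine ⟨m1 + m2 + m3, by omega, ?_⟩
  intro k k' l l' hk hk' hl hl' τ hkτ hlτ hKL σ d a ha hd
  have hlR : (m3 : ℝ) ≤ l := by exact_mod_cast (by omega : m3 ≤ l)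
  have hl1 : (1 : ℝ) ≤ l := by exact_mod_cast (by omega : 1 ≤ l)
  have hl1' : (1 : ℝ) ≤ l' := by exact_mod_cast (by omega : 1 ≤ l')
  have hk1 : (1 : ℝ) ≤ k := by exact_mod_cast (by omega : 1 ≤ k)
  have hk1' : (1 : ℝ) ≤ k' := by exact_mod_cast (by omega : 1 ≤ k')
  have hd0 : (0 : ℝ) < d := lt_of_lt_of_le (by positivity) hd
  have hd1 : 1 ≤ d := by exact_mod_cast hd0
  set K : ℝ := (k : ℝ) + k' with hK
  set L : ℝ := (l : ℝ) + l' with hL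
  have hK0 : 0 < K := by positivity
  have hL0 : 0 < L := by positivity
  have hKL2 : K ≤ 2 * L := by linarith
  set C' : ℤ := ⌊2 * ((l : ℝ) * d / L)⌋ with hC'
  set C : ℤ := ⌈2 * a⌉ + C' with hC
  have f1 := Int.floor_le (2 * ((l : ℝ) * d / L))
  have f2 := Int.lt_floor_add_one (2 * ((l : ℝ) * d / L))
  have f3 := Int.le_ceil (2 * a)
  have f4 := Int.ceil_lt_add_one (2 * a)
  rw [← hC'] at f1 f2
  have hσ : (0 : ℝ) ≤ σ := by positivity
  have t2 := H2 l l' d (by omega) (by omega) hd1 hd C' (by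
    rw [← hL, one_mul]
    have : 1 ≤ (L + d) / L := by rw [le_div_iff₀ hL0]; linarith
    rw [abs_le]; constructor <;> linarith)
  set U : ℕ := σ + d with hU
  have hUR : (U : ℝ) = σ + d := by rw [hU]; push_cast; ring
  have t1 := H1 k k' U (by omega) (by omega) (by omega) (by
    rw [← hK, hUR]; nlinarith) C (by
    rw [← hK]
    have g1 : |(l : ℝ) * d / L - τ * d| ≤ M * (d / L) := by
      have : (l : ℝ) * d / L - τ * d = (l - τ * L) * (d / L) := by field_simp
      rw [this, abs_mul, abs_of_pos (by positivity : 0 < (d : ℝ) / L)]; gcongr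
    have g2 : |(k : ℝ) * U / K - τ * U| ≤ M * (U / K) := by
      have : (k : ℝ) * U / K - τ * U = (k - τ * K) * (U / K) := by field_simp
      rw [this, abs_mul, abs_of_nonneg (by positivity : 0 ≤ (U : ℝ) / K)]; gcongr
    have g3 : M * ((d : ℝ) / L) ≤ M * (2 * (U / K)) := by
      gcongr
      rw [← mul_div_assoc, div_le_div_iff₀ hL0 hK0]
      have : (d : ℝ) ≤ U := by rw [hUR]; linarith
      calc (d : ℝ) * K ≤ U * (2 * L) := by gcongr
        _ = _ := by ring
    have e : (K + U) / K = 1 + U / K := by field_simp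
    have g4 : 0 ≤ (U : ℝ) / K := by positivity
    have g5 : 0 ≤ M * ((U : ℝ) / K) := by positivity
    rw [e, hC]
    push_cast
    have hτ : τ * U = τ * σ + τ * d := by rw [hUR]; ring
    rw [abs_le] at g1 g2 ha ⊢
    rw [hτ] at g2
    have g6 : (4 + 6 * M) * (1 + (U : ℝ) / K) = 4 + 6 * M + 4 * (U / K) + 6 * (M * (U / K)) := by ring
    rw [g6]
    constructor <;> linarith [g1.1, g1.2, g2.1, g2.2, ha.1, ha.2])
  have := prod_reflect (rr k k' U) (rr l l' d) (rr_nonneg _ _ _) (rr_nonneg _ _ _) (rr_summable' _ _ _) (rr_summable' _ _ _)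
    C C' (ε / 2) a t1 t2 (by rw [hC]; push_cast; linarith)
  have e : 2 * (ε / 2) = ε := by ring
  rw [e] at this
  exact this

def trm (s : ℝ) (k k' l l' : ℕ) (S D x y : ℤ) : ℝ :=
  cz k x * cz k' (S + D - x) * (cz l y * cz l' (D - y)) * s ^ (S + 2 * D).toNat

lemma trm_nonneg {s : ℝ} (hs : 0 ≤ s) (k k' l l' : ℕ) (S D x y : ℤ) : 0 ≤ trm s k k' l l' S D x y := by
  unfold trm
  have := cz_nonneg k x
  have := cz_nonneg k' (S + D - x)
  have := cz_nonneg l y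
  have := cz_nonneg l' (D - y)
  positivity

lemma trm_eq (s : ℝ) (k k' l l' σ d : ℕ) (x y : ℤ) :
    trm s k k' l l' σ d x y = (rr k k' (σ + d) x * rr l l' d y) * s ^ (σ + 2 * d) := by
  unfold trm rr
  have e : ((σ : ℤ) + 2 * (d : ℤ)).toNat = σ + 2 * d := by omega
  rw [e]; push_cast; ring

lemma trm_negD (s : ℝ) (k k' l l' : ℕ) (S D x y : ℤ) (hD : D < 0) : trm s k k' l l' S D x y = 0 := by
  unfold trm
  by_cases hy : y < 0
  · rw [cz_neg l hy]; ring
  · rw [cz_neg l' (by omega : D - y < 0)]; ring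

lemma trm_swap (s : ℝ) (k k' l l' : ℕ) (S D x y : ℤ) :
    trm s k k' l l' S D x y = trm s l' l k' k (-S) (S + D) (D - y) (S + D - x) := by
  unfold trm
  have e1 : -S + (S + D) - (D - y) = y := by ring
  have e2 : S + D - (S + D - x) = x := by ring
  have e3 : -S + 2 * (S + D) = S + 2 * D := by ring
  rw [e1, e2, e3]; ring

def zz (s : ℝ) (k k' l l' σ d : ℕ) : ℝ := (TT k k' (σ + d) * TT l l' d) * s ^ (σ + 2 * d)

lemma zz_nonneg {s : ℝ} (hs : 0 ≤ s) (k k' l l' σ d : ℕ) : 0 ≤ zz s k k' l l' σ d := by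
  unfold zz
  have := TT_nonneg k k' (σ + d)
  have := TT_nonneg l l' d
  positivity

lemma zz_double {s : ℝ} (hs : 0 ≤ s) (k k' l l' σ d : ℕ) (hk : 1 ≤ k)
    (hd : (d : ℝ) + 1 ≤ s ^ 2 * ((l : ℝ) + l') / 2) :
    2 * zz s k k' l l' σ d ≤ zz s k k' l l' σ (d + 1) := by
  unfold zz
  have h1 := TT_rec k k' (σ + d)
  have h2 := TT_rec l l' d
  have e : σ + (d + 1) = σ + d + 1 := by ring
  have e' : σ + 2 * (d + 1) = σ + 2 * d + 2 := by ring
  rw [e, e', pow_add s (σ + 2 * d) 2]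
  have p1 := TT_nonneg k k' (σ + d)
  have p2 := TT_nonneg l l' d
  have p3 := TT_nonneg k k' (σ + d + 1)
  have p4 := TT_nonneg l l' (d + 1)
  have hkR : (1 : ℝ) ≤ k := by exact_mod_cast hk
  have g1 : TT k k' (σ + d) ≤ TT k k' (σ + d + 1) := by
    have hpos : (0 : ℝ) < ((σ + d : ℕ) : ℝ) + 1 := by positivity
    refine le_of_mul_le_mul_left ?_ hpos
    rw [h1]
    apply mul_le_mul_of_nonneg_right _ p1
    have : (0 : ℝ) ≤ k' := by positivity
    linarith
  have g2 : 2 * TT l l' d ≤ TT l l' (d + 1) * s ^ 2 := by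
    have hpos : (0 : ℝ) < (d : ℝ) + 1 := by positivity
    refine le_of_mul_le_mul_left ?_ hpos
    have : ((d : ℝ) + 1) * (TT l l' (d + 1) * s ^ 2) = s ^ 2 * (((d : ℝ) + (l + l')) * TT l l' d) := by
      rw [← h2]; ring
    rw [this]
    have h3 : ((d : ℝ) + 1) * 2 ≤ s ^ 2 * ((d : ℝ) + (l + l')) := by
      have : 0 ≤ s ^ 2 * (d : ℝ) := by positivity
      nlinarith
    nlinarith
  have hp : 0 ≤ s ^ (σ + 2 * d) := by positivity
  calc 2 * (TT k k' (σ + d) * TT l l' d * s ^ (σ + 2 * d))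
      = TT k k' (σ + d) * (2 * TT l l' d) * s ^ (σ + 2 * d) := by ring
    _ ≤ TT k k' (σ + d + 1) * (TT l l' (d + 1) * s ^ 2) * s ^ (σ + 2 * d) := by gcongr
    _ = _ := by ring

lemma zz_pow {s : ℝ} (hs : 0 ≤ s) (k k' l l' σ d j : ℕ) (hk : 1 ≤ k)
    (hd : (d : ℝ) + j ≤ s ^ 2 * ((l : ℝ) + l') / 2) :
    2 ^ j * zz s k k' l l' σ d ≤ zz s k k' l l' σ (d + j) := by
  induction j with
  | zero => simp
  | succ j ih =>
    push_cast at hd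
    have h1 := ih (by linarith)
    have h2 := zz_double hs k k' l l' σ (d + j) hk (by push_cast; linarith)
    rw [pow_succ]
    calc _ = 2 * (2 ^ j * zz s k k' l l' σ d) := by ring
      _ ≤ 2 * zz s k k' l l' σ (d + j) := by gcongr
      _ ≤ _ := h2

lemma Zd_eq {s : ℝ} (hs : 0 ≤ s) (k k' l l' σ d : ℕ) :
    ∑' p : ℤ × ℤ, ENNReal.ofReal (trm s k k' l l' σ d p.1 p.2) = ENNReal.ofReal (zz s k k' l l' σ d) := by
  have hsum : Summable (fun p : ℤ × ℤ => rr k k' (σ + d) p.1 * rr l l' d p.2) :=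
    (rr_summable' _ _ _).mul_of_nonneg (rr_summable' _ _ _) (rr_nonneg _ _ _) (rr_nonneg _ _ _)
  rw [← ENNReal.ofReal_tsum_of_nonneg (fun p => trm_nonneg hs _ _ _ _ _ _ _ _)]
  · congr 1
    simp only [trm_eq]
    rw [tsum_mul_right]
    unfold zz TT
    rw [(rr_summable' k k' (σ + d)).tsum_mul_tsum (rr_summable' l l' d) hsum]
  · simp only [trm_eq]
    exact hsum.mul_right _

lemma Nd_eq {s : ℝ} (hs : 0 ≤ s) (k k' l l' σ d : ℕ) (a : ℝ) :
    ∑' p : ℤ × ℤ, (if a ≤ (p.1 : ℝ) - p.2 then ENNReal.ofReal (trm s k k' l l' σ d p.1 p.2) else 0) =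
      ENNReal.ofReal ((∑' p : ℤ × ℤ, if a ≤ (p.1 : ℝ) - p.2 then rr k k' (σ + d) p.1 * rr l l' d p.2 else 0)
        * s ^ (σ + 2 * d)) := by
  have hsum : Summable (fun p : ℤ × ℤ => rr k k' (σ + d) p.1 * rr l l' d p.2) :=
    (rr_summable' _ _ _).mul_of_nonneg (rr_summable' _ _ _) (rr_nonneg _ _ _) (rr_nonneg _ _ _)
  have hnn : ∀ p : ℤ × ℤ, 0 ≤ rr k k' (σ + d) p.1 * rr l l' d p.2 := fun p =>
    mul_nonneg (rr_nonneg _ _ _ _) (rr_nonneg _ _ _ _)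
  have hsum' : Summable (fun p : ℤ × ℤ => if a ≤ (p.1 : ℝ) - p.2 then rr k k' (σ + d) p.1 * rr l l' d p.2 else 0) := by
    refine Summable.of_nonneg_of_le (fun p => ?_) (fun p => ?_) hsum
    · split_ifs
      · exact hnn p
      · exact le_rfl
    · split_ifs
      · exact le_rfl
      · exact hnn p
  rw [← tsum_mul_right, ENNReal.ofReal_tsum_of_nonneg _ (hsum'.mul_right _)]
  · apply tsum_congr
    intro p
    split_ifs
    · rw [trm_eq]
    · simp
  · intro p
    have := hnn p
    split_ifs
    · positivity
    · simp

lemma main_nonneg (s M ε : ℝ) (hs : 0 < s) (hM : 0 ≤ M) (hε : 0 < ε) :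
    ∃ m : ℕ, 1 ≤ m ∧ ∀ k k' l l' : ℕ, m ≤ k → m ≤ k' → m ≤ l → m ≤ l' → ∀ τ : ℝ,
      |(k : ℝ) - τ * (k + k')| ≤ M → |(l : ℝ) - τ * (l + l')| ≤ M →
      (k : ℝ) + k' ≤ l + l' + M → ∀ (σ : ℕ) (a : ℝ), |a - τ * σ| ≤ 1 →
      ∑' p : ℤ × ℤ × ℤ, ENNReal.ofReal (trm s k k' l l' σ p.1 p.2.1 p.2.2) ≤
        2 * (∑' p : ℤ × ℤ × ℤ, if a ≤ (p.2.1 : ℝ) - p.2.2 then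
          ENNReal.ofReal (trm s k k' l l' σ p.1 p.2.1 p.2.2) else 0) +
        ENNReal.ofReal ε * ∑' p : ℤ × ℤ × ℤ, ENNReal.ofReal (trm s k k' l l' σ p.1 p.2.1 p.2.2) := by
  obtain ⟨m1, hm1, H⟩ := good_d (s ^ 2) M (ε / 2) (by positivity) hM (by positivity)
  obtain ⟨N, hN⟩ := exists_pow_lt_of_lt_one (by positivity : 0 < ε / 2) (by norm_num : (1 / 2 : ℝ) < 1)
  obtain ⟨m2, hm2⟩ := exists_nat_ge (4 * (N + 2) / s ^ 2)
  refine ⟨m1 + m2, by omega, ?_⟩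
  intro k k' l l' hk hk' hl hl' τ hkτ hlτ hKL σ a ha
  have hlR : (m2 : ℝ) ≤ l := by exact_mod_cast (by omega : m2 ≤ l)
  have hl'0 : (0 : ℝ) ≤ l' := by positivity
  have hs2 : 0 < s ^ 2 := by positivity
  have hL : 4 * ((N : ℝ) + 2) ≤ s ^ 2 * (l + l') := by
    rw [div_le_iff₀ hs2] at hm2
    nlinarith
  obtain ⟨n0, hn0⟩ : ∃ n0 : ℕ, n0 = ⌊s ^ 2 * ((l : ℝ) + l') / 4⌋₊ := ⟨_, rfl⟩
  have hn0le : (n0 : ℝ) ≤ s ^ 2 * ((l : ℝ) + l') / 4 := by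
    rw [hn0]; exact Nat.floor_le (by positivity)
  have hn0gt : s ^ 2 * ((l : ℝ) + l') / 4 < n0 + 1 := by
    rw [hn0]; exact Nat.lt_floor_add_one _
  have hNn0 : N ≤ n0 := by
    have : (N : ℝ) < n0 + 1 := by linarith
    have : N < n0 + 1 := by exact_mod_cast this
    omega
  have hhalf : (1 / 2 : ℝ) ^ n0 ≤ ε / 2 :=
    (pow_le_pow_of_le_one (by norm_num) (by norm_num) hNn0).trans hN.le
  set Zf : ℤ → ENNReal := fun D => ∑' p : ℤ × ℤ, ENNReal.ofReal (trm s k k' l l' σ D p.1 p.2) with hZf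
  set Nf : ℤ → ENNReal := fun D => ∑' p : ℤ × ℤ, (if a ≤ (p.1 : ℝ) - p.2 then
    ENNReal.ofReal (trm s k k' l l' σ D p.1 p.2) else 0) with hNf
  have key : ∀ D : ℤ, Zf D ≤ 2 * Nf D + ENNReal.ofReal (ε / 2) * Zf D + ENNReal.ofReal (ε / 2) * Zf (D + n0) := by
    intro D
    rcases lt_or_ge D 0 with hD | hD
    · have : Zf D = 0 := by
        simp only [hZf]
        simp [trm_negD _ _ _ _ _ _ _ _ _ hD]
      rw [this]; exact zero_le
    · obtain ⟨d, rfl⟩ := Int.eq_ofNat_of_zero_le hD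
      have hz : Zf (d : ℤ) = ENNReal.ofReal (zz s k k' l l' σ d) := Zd_eq hs.le _ _ _ _ _ _
      rcases lt_or_ge d n0 with hdn | hdn
      · have hz' : Zf ((d : ℤ) + n0) = ENNReal.ofReal (zz s k k' l l' σ (d + n0)) := by
          have := Zd_eq hs.le k k' l l' σ (d + n0)
          rw [← this]; simp only [hZf]; push_cast; rfl
        have hdR : (d : ℝ) ≤ n0 := by exact_mod_cast hdn.le
        have h := zz_pow hs.le k k' l l' σ d n0 (by omega) (by linarith)
        have h' : zz s k k' l l' σ d ≤ ε / 2 * zz s k k' l l' σ (d + n0) := by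
          have hnn := zz_nonneg hs.le k k' l l' σ (d + n0)
          calc zz s k k' l l' σ d = (1 / 2) ^ n0 * (2 ^ n0 * zz s k k' l l' σ d) := by
                rw [← mul_assoc, ← mul_pow]; norm_num
            _ ≤ (1 / 2) ^ n0 * zz s k k' l l' σ (d + n0) := by gcongr
            _ ≤ _ := by gcongr
        calc Zf d ≤ ENNReal.ofReal (ε / 2) * Zf (d + n0) := by
              rw [hz, hz', ← ENNReal.ofReal_mul (by positivity)]
              exact ENNReal.ofReal_le_ofReal h'
          _ ≤ _ := le_add_self
      · have hdR : (n0 : ℝ) ≤ d := by exact_mod_cast hdn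
        have hN0 : (0 : ℝ) ≤ N := by positivity
        have h := H k k' l l' (by omega) (by omega) (by omega) (by omega) τ hkτ hlτ hKL σ d a ha (by linarith)
        have hn : Nf (d : ℤ) = _ := Nd_eq hs.le k k' l l' σ d a
        set Q := ∑' p : ℤ × ℤ, if a ≤ (p.1 : ℝ) - p.2 then rr k k' (σ + d) p.1 * rr l l' d p.2 else 0 with hQ
        have hQ0 : 0 ≤ Q := tsum_nonneg (fun p => by
          split_ifs
          · exact mul_nonneg (rr_nonneg _ _ _ _) (rr_nonneg _ _ _ _)
          · exact le_rfl)
        have h2 : zz s k k' l l' σ d ≤ 2 * (Q * s ^ (σ + 2 * d)) + ε / 2 * zz s k k' l l' σ d := by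
          unfold zz
          have hp : 0 ≤ s ^ (σ + 2 * d) := by positivity
          calc _ ≤ (2 * Q + ε / 2 * (TT k k' (σ + d) * TT l l' d)) * s ^ (σ + 2 * d) := by gcongr
            _ = _ := by ring
        have hnn := zz_nonneg hs.le k k' l l' σ d
        calc Zf d ≤ 2 * Nf d + ENNReal.ofReal (ε / 2) * Zf d := by
              rw [hz, hn, ← ENNReal.ofReal_mul (by positivity),
                show (2 : ENNReal) = ENNReal.ofReal 2 by simp, ← ENNReal.ofReal_mul (by positivity),
                ← ENNReal.ofReal_add (by positivity) (by positivity)]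
              exact ENNReal.ofReal_le_ofReal h2
          _ ≤ _ := le_self_add
  have hZ : ∑' p : ℤ × ℤ × ℤ, ENNReal.ofReal (trm s k k' l l' σ p.1 p.2.1 p.2.2) = ∑' D, Zf D :=
    ENNReal.tsum_prod' (f := fun p : ℤ × ℤ × ℤ => ENNReal.ofReal (trm s k k' l l' σ p.1 p.2.1 p.2.2))
  have hN' : (∑' p : ℤ × ℤ × ℤ, if a ≤ (p.2.1 : ℝ) - p.2.2 then
          ENNReal.ofReal (trm s k k' l l' σ p.1 p.2.1 p.2.2) else 0) = ∑' D, Nf D :=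
    ENNReal.tsum_prod' (f := fun p : ℤ × ℤ × ℤ => if a ≤ (p.2.1 : ℝ) - p.2.2 then
          ENNReal.ofReal (trm s k k' l l' σ p.1 p.2.1 p.2.2) else 0)
  rw [hZ, hN']
  have hshift : ∑' D, Zf (D + n0) = ∑' D, Zf D := (Equiv.addRight (n0 : ℤ)).tsum_eq Zf
  calc ∑' D, Zf D ≤ ∑' D, (2 * Nf D + ENNReal.ofReal (ε / 2) * Zf D + ENNReal.ofReal (ε / 2) * Zf (D + n0)) :=
        ENNReal.tsum_le_tsum key
    _ = 2 * (∑' D, Nf D) + ENNReal.ofReal (ε / 2) * (∑' D, Zf D) + ENNReal.ofReal (ε / 2) * ∑' D, Zf D := by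
        rw [ENNReal.tsum_add, ENNReal.tsum_add, ENNReal.tsum_mul_left, ENNReal.tsum_mul_left,
          ENNReal.tsum_mul_left, hshift]
    _ = _ := by
        rw [add_assoc, ← add_mul, ← ENNReal.ofReal_add (by positivity) (by positivity)]
        congr 3; ring

lemma main_all (s M ε : ℝ) (hs : 0 < s) (hM : 0 ≤ M) (hε : 0 < ε) :
    ∃ m : ℕ, 1 ≤ m ∧ ∀ k k' l l' : ℕ, m ≤ k → m ≤ k' → m ≤ l → m ≤ l' → ∀ τ : ℝ,
      |(k : ℝ) - τ * (k + k')| ≤ M → |(l : ℝ) - τ * (l + l')| ≤ M →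
      |((k : ℝ) + k') - (l + l')| ≤ M → ∀ (S : ℤ) (a : ℝ), |a - τ * S| ≤ 1 →
      ∑' p : ℤ × ℤ × ℤ, ENNReal.ofReal (trm s k k' l l' S p.1 p.2.1 p.2.2) ≤
        2 * (∑' p : ℤ × ℤ × ℤ, if a ≤ (p.2.1 : ℝ) - p.2.2 then
          ENNReal.ofReal (trm s k k' l l' S p.1 p.2.1 p.2.2) else 0) +
        ENNReal.ofReal ε * ∑' p : ℤ × ℤ × ℤ, ENNReal.ofReal (trm s k k' l l' S p.1 p.2.1 p.2.2) := by
  obtain ⟨m, hm, H⟩ := main_nonneg s M ε hs hM hε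
  refine ⟨m, hm, ?_⟩
  intro k k' l l' hk hk' hl hl' τ hkτ hlτ hKL S a ha
  rw [abs_le] at hKL
  rcases le_or_gt 0 S with hS | hS
  · obtain ⟨σ, rfl⟩ := Int.eq_ofNat_of_zero_le hS
    exact H k k' l l' hk hk' hl hl' τ hkτ hlτ (by linarith) σ a (by exact_mod_cast ha)
  · obtain ⟨σ, hσ⟩ := Int.eq_ofNat_of_zero_le (by omega : 0 ≤ -S)
    have hσR : (σ : ℝ) = -(S : ℝ) := by
      have : ((-S : ℤ) : ℝ) = ((σ : ℤ) : ℝ) := by rw [hσ]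
      push_cast at this; linarith
    have h := H l' l k' k hl' hl hk' hk (1 - τ)
      (by rw [show (l' : ℝ) - (1 - τ) * (l' + l) = -(l - τ * (l + l')) by ring, abs_neg]; exact hlτ)
      (by rw [show (k' : ℝ) - (1 - τ) * (k' + k) = -(k - τ * (k + k')) by ring, abs_neg]; exact hkτ)
      (by linarith) σ (a - S)
      (by rw [show a - S - (1 - τ) * (σ : ℝ) = a - τ * S by rw [hσR]; ring]; exact ha)
    let e : ℤ × ℤ × ℤ ≃ ℤ × ℤ × ℤ :=
      { toFun := fun p => (S + p.1, p.1 - p.2.2, S + p.1 - p.2.1)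
        invFun := fun p => (p.1 - S, p.1 - p.2.2, p.1 - S - p.2.1)
        left_inv := fun p => by ext <;> simp
        right_inv := fun p => by ext <;> simp }
    have e1 : ∑' p : ℤ × ℤ × ℤ, ENNReal.ofReal (trm s l' l k' k σ p.1 p.2.1 p.2.2) =
        ∑' p : ℤ × ℤ × ℤ, ENNReal.ofReal (trm s k k' l l' S p.1 p.2.1 p.2.2) := by
      rw [← e.tsum_eq]
      apply tsum_congr
      intro p
      rw [trm_swap s k k' l l' S, hσ]; rfl
    have e2 : (∑' p : ℤ × ℤ × ℤ, if a - S ≤ (p.2.1 : ℝ) - p.2.2 then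
          ENNReal.ofReal (trm s l' l k' k σ p.1 p.2.1 p.2.2) else 0) =
        ∑' p : ℤ × ℤ × ℤ, if a ≤ (p.2.1 : ℝ) - p.2.2 then
          ENNReal.ofReal (trm s k k' l l' S p.1 p.2.1 p.2.2) else 0 := by
      rw [← e.tsum_eq]
      apply tsum_congr
      intro p
      rw [trm_swap s k k' l l' S, hσ]
      have : (a - S ≤ (((e p).2.1 : ℤ) : ℝ) - (((e p).2.2 : ℤ) : ℝ)) ↔ (a ≤ (p.2.1 : ℝ) - p.2.2) := by
        simp only [e, Equiv.coe_fn_mk]; push_cast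
        constructor <;> intro h <;> linarith
      simp only [this]; rfl
    rw [e1, e2] at h
    exact h

lemma card_fun_sum (α : Type) [Fintype α] [DecidableEq α] (n : ℕ) :
    Nat.card {w : α → ℕ // ∑ i, w i = n} = Nat.multichoose (Fintype.card α) n := by
  rw [← Sym.card_sym_eq_multichoose, ← Nat.card_eq_fintype_card]
  exact (Nat.card_congr (Sym.equivNatSumOfFintype α n)).symm

lemma finite_fun_sum (α : Type) [Fintype α] [DecidableEq α] (n : ℕ) :
    Finite {w : α → ℕ // ∑ i, w i = n} :=
  Finite.of_equiv _ (Sym.equivNatSumOfFintype α n)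

def labEquiv {ι γ : Type} [Fintype ι] [DecidableEq ι] [DecidableEq γ] (lab : ι → γ) (x : γ → ℕ) :
    {v : ι → ℕ // (fun c => ∑ i : {i // lab i = c}, v i) = x} ≃
      ((c : γ) → {w : {i // lab i = c} → ℕ // ∑ i, w i = x c}) where
  toFun v := fun c => ⟨fun i => v.1 i, congrFun v.2 c⟩
  invFun w := ⟨fun i => (w (lab i)).1 ⟨i, rfl⟩, by
    funext c
    rw [← (w c).2]
    apply Finset.sum_congr rfl
    rintro ⟨i, rfl⟩ _
    rfl⟩
  left_inv v := by ext i; rfl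
  right_inv w := by
    funext c
    ext ⟨i, rfl⟩
    rfl

lemma tsum_lab {ι γ : Type} [Fintype ι] [DecidableEq ι] [Fintype γ] [DecidableEq γ] (lab : ι → γ)
    (F : (γ → ℕ) → ENNReal) :
    ∑' v : ι → ℕ, F (fun c => ∑ i : {i // lab i = c}, v i) =
      ∑' x : γ → ℕ, ((∏ c, Nat.multichoose (Fintype.card {i // lab i = c}) (x c) : ℕ) : ENNReal) * F x := by
  rw [← (Equiv.sigmaFiberEquiv (fun v : ι → ℕ => (fun c => ∑ i : {i // lab i = c}, v i))).tsum_eq,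
    ENNReal.tsum_sigma']
  apply tsum_congr
  intro x
  have : ∀ v : {v : ι → ℕ // (fun c => ∑ i : {i // lab i = c}, v i) = x},
      F (fun c => ∑ i : {i // lab i = c}, (Equiv.sigmaFiberEquiv
        (fun v : ι → ℕ => (fun c => ∑ i : {i // lab i = c}, v i)) ⟨x, v⟩) i) = F x := by
    intro v
    exact congrArg F v.2
  rw [tsum_congr this, ENNReal.tsum_const]
  congr 1
  have : ∀ c, Finite {w : {i // lab i = c} → ℕ // ∑ i, w i = x c} := fun c => finite_fun_sum _ _
  have : Finite {v : ι → ℕ // (fun c => ∑ i : {i // lab i = c}, v i) = x} :=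
    Finite.of_equiv _ (labEquiv lab x).symm
  rw [ENat.card_eq_coe_natCard, Nat.card_congr (labEquiv lab x), Nat.card_pi]
  simp only [card_fun_sum]
  exact ENat.toENNReal_coe _

lemma tsum_geom_ne_top {ι : Type} [Fintype ι] [DecidableEq ι] {s : ℝ} (hs : 0 ≤ s) (hs1 : s < 1) :
    ∑' v : ι → ℕ, ENNReal.ofReal (s ^ ∑ i, v i) ≠ ⊤ := by
  have h := tsum_lab (fun _ : ι => ()) (fun x => ENNReal.ofReal (s ^ x ()))
  have e : ∀ v : ι → ℕ, ∑ i : {i : ι // () = ()}, v i = ∑ i, v i := by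
    intro v
    exact Fintype.sum_equiv (Equiv.subtypeUnivEquiv (fun _ => rfl)) _ _ (fun _ => rfl)
  simp only [e] at h
  rw [h, ← (Equiv.funUnique Unit ℕ).symm.tsum_eq]
  simp only [Finset.univ_unique, Finset.prod_singleton]
  have hb : ∀ k n : ℕ, ((Nat.multichoose k n : ℕ) : ENNReal) * ENNReal.ofReal (s ^ n) ≤
      ENNReal.ofReal (((n + k).choose k : ℝ) * s ^ n) := by
    intro k n
    rw [ENNReal.ofReal_mul (by positivity), ENNReal.ofReal_natCast]
    gcongr
    rw [Nat.multichoose_eq]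
    rcases Nat.eq_zero_or_pos k with rfl | hk
    · rcases Nat.eq_zero_or_pos n with rfl | hn
      · simp
      · rw [Nat.choose_eq_zero_of_lt (by omega)]; simp
    · rw [← Nat.choose_symm_of_eq_add (show n + k = n + k from rfl)]
      exact Nat.choose_le_choose _ (by omega)
  refine ne_top_of_le_ne_top ?_ (ENNReal.tsum_le_tsum (fun n => hb _ n))
  have hsum := fun k => summable_choose_mul_geometric_of_norm_lt_one k (r := s) (by rw [Real.norm_of_nonneg hs]; exact hs1)
  rw [← ENNReal.ofReal_tsum_of_nonneg (fun n => by positivity) (hsum _)]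
  exact ENNReal.ofReal_ne_top

def sg (b : Bool) : ℤ := if b then 1 else -1

lemma tsum_signed {ι : Type} [Fintype ι] [DecidableEq ι] (up left : ι → Bool) {s : ℝ} (hs : 0 ≤ s)
    (S : ℤ) (G : ℤ → ENNReal) (k k' l l' : ℕ)
    (hk : Fintype.card {i // (up i, left i) = (true, true)} = k)
    (hk' : Fintype.card {i // (up i, left i) = (true, false)} = k')
    (hl : Fintype.card {i // (up i, left i) = (false, true)} = l)
    (hl' : Fintype.card {i // (up i, left i) = (false, false)} = l') :
    ∑' v : ι → ℕ, (if ∑ i, sg (up i) * (v i : ℤ) = S then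
      G (∑ i, if left i then sg (up i) * (v i : ℤ) else 0) * ENNReal.ofReal (s ^ ∑ i, v i) else 0) =
    ∑' p : ℤ × ℤ × ℤ, G (p.2.1 - p.2.2) * ENNReal.ofReal (trm s k k' l l' S p.1 p.2.1 p.2.2) := by
  let cn : (Bool × Bool → ℕ) → Prop := fun x =>
    ((x (true, true) : ℤ) + x (true, false)) - (x (false, true) + x (false, false)) = S
  let F : (Bool × Bool → ℕ) → ENNReal := fun x => if cn x then
      G ((x (true, true) : ℤ) - x (false, true)) *
        ENNReal.ofReal (s ^ (x (true, true) + x (true, false) + x (false, true) + x (false, false))) else 0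
  have h := tsum_lab (fun i => (up i, left i)) F
  have e0 : ∀ (v : ι → ℕ) (c : Bool × Bool), ∑ i : {i // (up i, left i) = c}, v i =
      ∑ i, if (up i, left i) = c then v i else 0 := by
    intro v c
    rw [← Finset.sum_filter]
    exact (Finset.sum_subtype _ (by simp) _).symm
  have h1 : ∀ v : ι → ℕ, (if ∑ i, sg (up i) * (v i : ℤ) = S then
      G (∑ i, if left i then sg (up i) * (v i : ℤ) else 0) * ENNReal.ofReal (s ^ ∑ i, v i) else 0) =
      F (fun c => ∑ i : {i // (up i, left i) = c}, v i) := by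
    intro v
    simp only [F, cn, e0]
    have a1 : ∑ i, sg (up i) * (v i : ℤ) = ((∑ i, if (up i, left i) = (true, true) then v i else 0 : ℕ) : ℤ)
        + (∑ i, if (up i, left i) = (true, false) then v i else 0 : ℕ)
        - ((∑ i, if (up i, left i) = (false, true) then v i else 0 : ℕ)
        + (∑ i, if (up i, left i) = (false, false) then v i else 0 : ℕ)) := by
      push_cast
      rw [← Finset.sum_add_distrib, ← Finset.sum_add_distrib, ← Finset.sum_sub_distrib]
      apply Finset.sum_congr rfl
      intro i _
      cases up i <;> cases left i <;> simp [sg]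
    have a2 : (∑ i, if left i then sg (up i) * (v i : ℤ) else 0) =
        ((∑ i, if (up i, left i) = (true, true) then v i else 0 : ℕ) : ℤ)
        - (∑ i, if (up i, left i) = (false, true) then v i else 0 : ℕ) := by
      push_cast
      rw [← Finset.sum_sub_distrib]
      apply Finset.sum_congr rfl
      intro i _
      cases up i <;> cases left i <;> simp [sg]
    have a3 : ∑ i, v i = (∑ i, if (up i, left i) = (true, true) then v i else 0)
        + (∑ i, if (up i, left i) = (true, false) then v i else 0)
        + (∑ i, if (up i, left i) = (false, true) then v i else 0)
        + (∑ i, if (up i, left i) = (false, false) then v i else 0) := by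
      rw [← Finset.sum_add_distrib, ← Finset.sum_add_distrib, ← Finset.sum_add_distrib]
      apply Finset.sum_congr rfl
      intro i _
      cases up i <;> cases left i <;> simp
    rw [a1, a2, ← a3]
  rw [tsum_congr h1, h]
  let g : {x // cn x} → ℤ × ℤ × ℤ := fun x =>
    ((x.1 (false, true) : ℤ) + x.1 (false, false), (x.1 (true, true) : ℤ), (x.1 (false, true) : ℤ))
  have hg : Function.Injective g := by
    rintro ⟨x, hx⟩ ⟨y, hy⟩ hxy
    simp only [g, Prod.mk.injEq, cn] at hxy hx hy
    obtain ⟨b1, b2, b3⟩ := hxy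
    apply Subtype.ext
    funext ⟨c1, c2⟩
    cases c1 <;> cases c2 <;> simp only <;> omega
  have hsupp : Function.support (fun p : ℤ × ℤ × ℤ => G (p.2.1 - p.2.2) *
      ENNReal.ofReal (trm s k k' l l' S p.1 p.2.1 p.2.2)) ⊆ Set.range g := by
    rintro ⟨D, x, y⟩ hp
    have ht : trm s k k' l l' S D x y ≠ 0 := by
      intro h0
      apply hp
      simp [h0]
    have hx : 0 ≤ x := by
      by_contra hc
      exact ht (by unfold trm; rw [cz_neg k (by omega : x < 0)]; ring)
    have hx' : 0 ≤ S + D - x := by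
      by_contra hc
      exact ht (by unfold trm; rw [cz_neg k' (by omega : S + D - x < 0)]; ring)
    have hy : 0 ≤ y := by
      by_contra hc
      exact ht (by unfold trm; rw [cz_neg l (by omega : y < 0)]; ring)
    have hy' : 0 ≤ D - y := by
      by_contra hc
      exact ht (by unfold trm; rw [cz_neg l' (by omega : D - y < 0)]; ring)
    refine ⟨⟨fun c => (match c with
      | (true, true) => x.toNat
      | (true, false) => (S + D - x).toNat
      | (false, true) => y.toNat
      | (false, false) => (D - y).toNat), ?_⟩, ?_⟩
    · simp only [cn]; omega
    · simp only [g, Prod.mk.injEq]; omega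
  rw [← hg.tsum_eq hsupp]
  have h2 : ∀ x : Bool × Bool → ℕ, ((∏ c, Nat.multichoose (Fintype.card {i // (up i, left i) = c}) (x c) : ℕ) : ENNReal)
      * F x = ({x | cn x} : Set _).indicator (fun x => ((∏ c, Nat.multichoose (Fintype.card {i // (up i, left i) = c}) (x c) : ℕ) : ENNReal) * (G ((x (true, true) : ℤ) - x (false, true)) *
        ENNReal.ofReal (s ^ (x (true, true) + x (true, false) + x (false, true) + x (false, false))))) x := by
    intro x
    simp only [F, Set.indicator_apply, Set.mem_ofPred_eq]
    split_ifs <;> simp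
  rw [tsum_congr h2, ← tsum_subtype]
  apply tsum_congr
  rintro ⟨x, hx⟩
  simp only [Set.mem_ofPred_eq, cn] at hx
  have e3 : S + ((x (false, true) : ℤ) + x (false, false)) - x (true, true) = (x (true, false) : ℕ) := by
    omega
  have e4 : ((x (false, true) : ℤ) + x (false, false)) - x (false, true) = (x (false, false) : ℕ) := by
    omega
  have e5 : (S + 2 * ((x (false, true) : ℤ) + x (false, false))).toNat =
      x (true, true) + x (true, false) + x (false, true) + x (false, false) := by omega
  simp only [g, trm, e3, e4, e5, cz_natCast]
  rw [Fintype.prod_prod_type, Fintype.prod_bool, Fintype.prod_bool, Fintype.prod_bool, hk, hk', hl, hl']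
  rw [ENNReal.ofReal_mul (by positivity)]
  have e6 : ENNReal.ofReal ((k.multichoose (x (true, true)) : ℝ) * (k'.multichoose (x (true, false)) : ℝ) *
     ((l.multichoose (x (false, true)) : ℝ) * (l'.multichoose (x (false, false)) : ℝ))) =
      ((k.multichoose (x (true, true)) * k'.multichoose (x (true, false)) *
     (l.multichoose (x (false, true)) * l'.multichoose (x (false, false))) : ℕ) : ENNReal) := by
    rw [← ENNReal.ofReal_natCast]; push_cast; rfl
  rw [e6]
  ring

abbrev Ix (n1 n3 : ℤ) : Type := {n : ℤ // n ∈ Finset.Ioc n1 n3}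

def pathOf (n1 n3 a1 : ℤ) (u : ℤ → Bool) (β : ℤ → ℕ) (v : Ix n1 n3 → ℕ) : ℤ → ℤ :=
  fun m => a1 + ∑ i : Ix n1 n3, if i.1 ≤ m then sg (u i) * ((v i : ℤ) + β i) else 0

def PP (n1 n3 a1 a3 : ℤ) (u : ℤ → Bool) (β : ℤ → ℕ) : Set (ℤ → ℤ) :=
  {f | (∀ m, m ≤ n1 → f m = a1) ∧ (∀ m, n3 ≤ m → f m = a3) ∧
    ∀ n, n1 < n → n ≤ n3 → ∃ v : ℕ, f n - f (n - 1) = sg (u n) * ((v : ℤ) + β n)}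

lemma sg_cases (b : Bool) : sg b = 1 ∨ sg b = -1 := by cases b <;> simp [sg]

lemma sg_mul_natAbs (b : Bool) (n : ℕ) : (sg b * (n : ℤ)).natAbs = n := by
  cases b <;> simp [sg]

lemma pathOf_inc {n1 n3 a1 : ℤ} {u : ℤ → Bool} {β : ℤ → ℕ} (v : Ix n1 n3 → ℕ) (i : Ix n1 n3) :
    pathOf n1 n3 a1 u β v i.1 - pathOf n1 n3 a1 u β v (i.1 - 1) = sg (u i) * ((v i : ℤ) + β i) := by
  unfold pathOf
  rw [add_sub_add_left_eq_sub, ← Finset.sum_sub_distrib]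
  rw [Finset.sum_eq_single i]
  · simp
  · intro j _ hj
    have : j.1 ≠ i.1 := fun h => hj (Subtype.ext h)
    by_cases h : j.1 ≤ i.1
    · rw [if_pos h, if_pos (by omega), sub_self]
    · rw [if_neg h, if_neg (by omega), sub_self]
  · simp

lemma pathOf_low {n1 n3 a1 : ℤ} {u : ℤ → Bool} {β : ℤ → ℕ} (v : Ix n1 n3 → ℕ) (m : ℤ) (hm : m ≤ n1) :
    pathOf n1 n3 a1 u β v m = a1 := by
  unfold pathOf
  rw [Finset.sum_eq_zero, add_zero]
  intro i _
  have := Finset.mem_Ioc.1 i.2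
  rw [if_neg (by omega)]

lemma pathOf_high {n1 n3 a1 : ℤ} {u : ℤ → Bool} {β : ℤ → ℕ} (v : Ix n1 n3 → ℕ) (m : ℤ) (hm : n3 ≤ m) :
    pathOf n1 n3 a1 u β v m = a1 + ∑ i : Ix n1 n3, sg (u i) * ((v i : ℤ) + β i) := by
  unfold pathOf
  congr 1
  apply Finset.sum_congr rfl
  intro i _
  have := Finset.mem_Ioc.1 i.2
  rw [if_pos (by omega)]

lemma pathOf_inj (n1 n3 a1 : ℤ) (u : ℤ → Bool) (β : ℤ → ℕ) : Function.Injective (pathOf n1 n3 a1 u β) := by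
  intro v w h
  funext i
  have h1 := pathOf_inc (a1 := a1) (u := u) (β := β) v i
  have h2 := pathOf_inc (a1 := a1) (u := u) (β := β) w i
  rw [h, h2] at h1
  rcases sg_cases (u i) with hs | hs <;> rw [hs] at h1 <;> omega

lemma pathOf_surj (n1 n3 a1 a3 : ℤ) (h13 : n1 ≤ n3) (u : ℤ → Bool) (β : ℤ → ℕ) (f : ℤ → ℤ)
    (hf : f ∈ PP n1 n3 a1 a3 u β) : ∃ v, pathOf n1 n3 a1 u β v = f := by
  obtain ⟨h1, h3, h⟩ := hf
  have h' : ∀ i : Ix n1 n3, ∃ v : ℕ, f i - f (i - 1) = sg (u i) * ((v : ℤ) + β i) := fun i =>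
    h i (Finset.mem_Ioc.1 i.2).1 (Finset.mem_Ioc.1 i.2).2
  choose v hv using h'
  refine ⟨v, ?_⟩
  have key : ∀ m, n1 ≤ m → pathOf n1 n3 a1 u β v m = f m := by
    intro m hm
    induction m, hm using Int.leInduction with
    | base => rw [pathOf_low _ _ le_rfl, h1 _ le_rfl]
    | succ m hm ih =>
      by_cases hmn : m + 1 ≤ n3
      · have := pathOf_inc (a1 := a1) (u := u) (β := β) v ⟨m + 1, Finset.mem_Ioc.2 ⟨by omega, hmn⟩⟩
        have h2 := hv ⟨m + 1, Finset.mem_Ioc.2 ⟨by omega, hmn⟩⟩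
        rw [← h2] at this
        simp only [add_sub_cancel_right] at this
        omega
      · have e1 : f (m + 1) = f m := by rw [h3 _ (by omega), h3 _ (by omega)]
        rw [e1, ← ih, pathOf_high _ _ (by omega), pathOf_high _ _ (by omega)]
  funext m
  rcases le_total n1 m with hm | hm
  · exact key m hm
  · rw [pathOf_low _ _ hm, h1 _ hm]

lemma pathOf_mem (n1 n3 a1 a3 : ℤ) (u : ℤ → Bool) (β : ℤ → ℕ) (v : Ix n1 n3 → ℕ) (h13 : n1 ≤ n3)  :
    pathOf n1 n3 a1 u β v ∈ PP n1 n3 a1 a3 u β ↔ ∑ i : Ix n1 n3, sg (u i) * ((v i : ℤ) + β i) = a3 - a1 := by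
  constructor
  · rintro ⟨_, h3, _⟩
    have := h3 n3 le_rfl
    rw [pathOf_high _ _ le_rfl] at this
    omega
  · intro h
    refine ⟨fun m hm => pathOf_low _ _ hm, fun m hm => ?_, fun n hn hn' => ?_⟩
    · rw [pathOf_high _ _ hm, h]; ring
    · exact ⟨v ⟨n, Finset.mem_Ioc.2 ⟨hn, hn'⟩⟩, pathOf_inc v ⟨n, Finset.mem_Ioc.2 ⟨hn, hn'⟩⟩⟩

lemma prod_Icc_Ix (n1 n3 : ℤ) (F : ℤ → ℝ) : ∏ k ∈ Finset.Icc (n1 + 1) n3, F k = ∏ i : Ix n1 n3, F i := by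
  have : Finset.Icc (n1 + 1) n3 = Finset.Ioc n1 n3 := by ext x; simp
  rw [this]
  exact Finset.prod_subtype _ (fun x => Iff.rfl) _

lemma weight_pathOf (n1 n3 a1 : ℤ) (u : ℤ → Bool) (β : ℤ → ℕ) (v : Ix n1 n3 → ℕ) (c s : ℝ) :
    ∏ k ∈ Finset.Icc (n1 + 1) n3, (c * s ^ (pathOf n1 n3 a1 u β v k - pathOf n1 n3 a1 u β v (k - 1)).natAbs) =
      (c ^ Fintype.card (Ix n1 n3) * s ^ (∑ i : Ix n1 n3, β i)) * s ^ (∑ i, v i) := by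
  rw [prod_Icc_Ix]
  have : ∀ i : Ix n1 n3, c * s ^ (pathOf n1 n3 a1 u β v i - pathOf n1 n3 a1 u β v (i - 1)).natAbs =
      c * s ^ (v i + β i) := by
    intro i
    rw [pathOf_inc]
    have := sg_mul_natAbs (u i) (v i + β i)
    push_cast at this
    rw [this]
  simp only [this]
  rw [Finset.prod_mul_distrib, Finset.prod_const, Finset.prod_pow_eq_pow_sum, Finset.sum_add_distrib, pow_add]
  rw [Finset.card_univ]
  ring

lemma path_sum (n1 n2 n3 a1 a3 : ℤ) (h13 : n1 ≤ n3) (u : ℤ → Bool) (β : ℤ → ℕ)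
    (hβ : ∀ n, n ≤ n2 → β n = 0) (c s : ℝ) (hc : 0 ≤ c) (hs : 0 ≤ s) (G : ℤ → ENNReal)
    (k k' l l' : ℕ) (S : ℤ) (hS : S = a3 - a1 - ∑ i : Ix n1 n3, sg (u i) * (β i : ℤ))
    (hk : Fintype.card {i : Ix n1 n3 // (u i, decide (i.1 ≤ n2)) = (true, true)} = k)
    (hk' : Fintype.card {i : Ix n1 n3 // (u i, decide (i.1 ≤ n2)) = (true, false)} = k')
    (hl : Fintype.card {i : Ix n1 n3 // (u i, decide (i.1 ≤ n2)) = (false, true)} = l)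
    (hl' : Fintype.card {i : Ix n1 n3 // (u i, decide (i.1 ≤ n2)) = (false, false)} = l') :
    ∑' f : PP n1 n3 a1 a3 u β, G (f.1 n2 - a1) * ENNReal.ofReal
        (∏ k ∈ Finset.Icc (n1 + 1) n3, (c * s ^ (f.1 k - f.1 (k - 1)).natAbs)) =
      ENNReal.ofReal (c ^ Fintype.card (Ix n1 n3) * s ^ (∑ i : Ix n1 n3, β i)) *
      ∑' p : ℤ × ℤ × ℤ, G (p.2.1 - p.2.2) * ENNReal.ofReal (trm s k k' l l' S p.1 p.2.1 p.2.2) := by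
  rw [← tsum_signed (fun i : Ix n1 n3 => u i) (fun i => decide (i.1 ≤ n2)) hs S G k k' l l' hk hk' hl hl',
    ← ENNReal.tsum_mul_left]
  rw [tsum_subtype (PP n1 n3 a1 a3 u β) (fun f => G (f n2 - a1) * ENNReal.ofReal
        (∏ k ∈ Finset.Icc (n1 + 1) n3, (c * s ^ (f k - f (k - 1)).natAbs)))]
  rw [← (pathOf_inj n1 n3 a1 u β).tsum_eq]
  · apply tsum_congr
    intro v
    have hm := pathOf_mem n1 n3 a1 a3 u β v h13
    have e : (∑ i : Ix n1 n3, sg (u i) * ((v i : ℤ) + β i) = a3 - a1) ↔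
        (∑ i : Ix n1 n3, sg (u i) * (v i : ℤ) = S) := by
      simp only [mul_add, Finset.sum_add_distrib]
      omega
    rw [e] at hm
    by_cases h : ∑ i : Ix n1 n3, sg (u i) * (v i : ℤ) = S
    · rw [Set.indicator_of_mem (hm.2 h), if_pos h, weight_pathOf, ENNReal.ofReal_mul (by positivity)]
      have e2 : pathOf n1 n3 a1 u β v n2 - a1 =
          ∑ i : Ix n1 n3, if decide (i.1 ≤ n2) = true then sg (u i) * (v i : ℤ) else 0 := by
        unfold pathOf
        rw [add_sub_cancel_left]
        apply Finset.sum_congr rfl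
        intro i _
        by_cases hi : i.1 ≤ n2
        · simp [hi, hβ _ hi]
        · simp [hi]
      rw [e2]
      ring
    · rw [Set.indicator_of_notMem (fun hh => h (hm.1 hh)), if_neg h, mul_zero]
  · intro f hf
    have hf' : f ∈ PP n1 n3 a1 a3 u β := by
      by_contra hc
      exact hf (Set.indicator_of_notMem hc _)
    exact pathOf_surj n1 n3 a1 a3 h13 u β f hf'

lemma trm_ne_top {ι : Type} [Fintype ι] [DecidableEq ι] (up left : ι → Bool) {s : ℝ} (hs : 0 ≤ s) (hs1 : s < 1)
    (S : ℤ) (k k' l l' : ℕ)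
    (hk : Fintype.card {i // (up i, left i) = (true, true)} = k)
    (hk' : Fintype.card {i // (up i, left i) = (true, false)} = k')
    (hl : Fintype.card {i // (up i, left i) = (false, true)} = l)
    (hl' : Fintype.card {i // (up i, left i) = (false, false)} = l') :
    ∑' p : ℤ × ℤ × ℤ, ENNReal.ofReal (trm s k k' l l' S p.1 p.2.1 p.2.2) ≠ ⊤ := by
  have h := tsum_signed up left hs S (fun _ => 1) k k' l l' hk hk' hl hl'
  simp only [one_mul] at h
  rw [← h]
  refine ne_top_of_le_ne_top (tsum_geom_ne_top (ι := ι) hs hs1) (ENNReal.tsum_le_tsum fun v => ?_)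
  split_ifs
  · exact le_rfl
  · exact zero_le

lemma trm_ne_zero {s : ℝ} (hs : 0 < s) (S : ℤ) {k k' l l' : ℕ} (hk : 1 ≤ k) (hk' : 1 ≤ k') (hl : 1 ≤ l)
    (hl' : 1 ≤ l') :
    ∑' p : ℤ × ℤ × ℤ, ENNReal.ofReal (trm s k k' l l' S p.1 p.2.1 p.2.2) ≠ 0 := by
  intro h
  rw [ENNReal.tsum_eq_zero] at h
  have := h (max 0 (-S), 0, 0)
  rw [ENNReal.ofReal_eq_zero] at this
  have h1 := cz_pos hk (le_refl 0)
  have h2 := cz_pos hk' (by omega : 0 ≤ S + max 0 (-S) - 0)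
  have h3 := cz_pos hl (le_refl 0)
  have h4 := cz_pos hl' (by omega : 0 ≤ max 0 (-S) - 0)
  have : 0 < trm s k k' l l' S (max 0 (-S)) 0 0 := by unfold trm; positivity
  simp only at *
  linarith

lemma cnt_even (a b : ℤ) (hab : a ≤ b) :
    2 * (((Finset.Ioc a b).filter (fun n => Even n)).card : ℤ) = b - a + a % 2 - b % 2 := by
  induction b, hab using Int.leInduction with
  | base => simp
  | succ b hb ih =>
    have e : Finset.Ioc a (b + 1) = insert (b + 1) (Finset.Ioc a b) := by
      ext x; simp only [Finset.mem_Ioc, Finset.mem_insert]; omega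
    rw [e, Finset.filter_insert]
    split_ifs with h
    · rw [Finset.card_insert_of_notMem (by simp)]
      rw [Int.even_iff] at h
      push_cast
      omega
    · rw [Int.even_iff] at h
      omega

lemma cnt_odd (a b : ℤ) (hab : a ≤ b) :
    2 * (((Finset.Ioc a b).filter (fun n => ¬ Even n)).card : ℤ) = b - a - a % 2 + b % 2 := by
  have h := cnt_even a b hab
  have h2 := Finset.card_filter_add_card_filter_not (s := Finset.Ioc a b) (fun n => Even n)
  rw [Int.card_Ioc] at h2
  omega

lemma card_Ix (n1 n3 : ℤ) (p : ℤ → Prop) [DecidablePred p] :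
    Fintype.card {i : Ix n1 n3 // p i.1} = ((Finset.Ioc n1 n3).filter p).card := by
  rw [← Fintype.card_coe]
  exact Fintype.card_congr
    ⟨fun i => ⟨i.1.1, Finset.mem_filter.2 ⟨i.1.2, i.2⟩⟩,
     fun i => ⟨⟨i.1, (Finset.mem_filter.1 i.2).1⟩, (Finset.mem_filter.1 i.2).2⟩,
     fun _ => rfl, fun _ => rfl⟩

lemma sandwich (A B : Finset ℤ) (x : ℤ) (h1 : A ⊆ B) (h2 : B ⊆ insert x A) :
    A.card ≤ B.card ∧ B.card ≤ A.card + 1 :=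
  ⟨Finset.card_le_card h1, (Finset.card_le_card h2).trans (Finset.card_insert_le _ _)⟩

lemma counts (n1 n2 n3 : ℤ) (h12 : n1 ≤ n2) (h23 : n2 < n3) (u : ℤ → Bool)
    (hu : ∀ n, n < n3 → u n = decide (Even n)) (k k' l l' : ℕ)
    (hk : Fintype.card {i : Ix n1 n3 // (u i, decide (i.1 ≤ n2)) = (true, true)} = k)
    (hk' : Fintype.card {i : Ix n1 n3 // (u i, decide (i.1 ≤ n2)) = (true, false)} = k')
    (hl : Fintype.card {i : Ix n1 n3 // (u i, decide (i.1 ≤ n2)) = (false, true)} = l)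
    (hl' : Fintype.card {i : Ix n1 n3 // (u i, decide (i.1 ≤ n2)) = (false, false)} = l') :
    |2 * (k : ℤ) - (n2 - n1)| ≤ 1 ∧ |2 * (l : ℤ) - (n2 - n1)| ≤ 1 ∧
    |2 * (k' : ℤ) - (n3 - n2)| ≤ 2 ∧ |2 * (l' : ℤ) - (n3 - n2)| ≤ 2 := by
  rw [card_Ix n1 n3 (fun n => (u n, decide (n ≤ n2)) = (true, true))] at hk
  rw [card_Ix n1 n3 (fun n => (u n, decide (n ≤ n2)) = (true, false))] at hk'
  rw [card_Ix n1 n3 (fun n => (u n, decide (n ≤ n2)) = (false, true))] at hl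
  rw [card_Ix n1 n3 (fun n => (u n, decide (n ≤ n2)) = (false, false))] at hl'
  simp only [Prod.mk.injEq, decide_eq_true_eq, decide_eq_false_iff_not, not_le] at hk hk' hl hl'
  have e1 : (Finset.Ioc n1 n3).filter (fun n => u n = true ∧ n ≤ n2) = (Finset.Ioc n1 n2).filter (fun n => Even n) := by
    ext x
    simp only [Finset.mem_filter, Finset.mem_Ioc]
    constructor
    · rintro ⟨⟨a, b⟩, c, d⟩
      rw [hu x (by omega), decide_eq_true_eq] at c
      exact ⟨⟨a, d⟩, c⟩
    · rintro ⟨⟨a, b⟩, c⟩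
      refine ⟨⟨a, by omega⟩, ?_, b⟩
      rw [hu x (by omega), decide_eq_true_eq]; exact c
  have e2 : (Finset.Ioc n1 n3).filter (fun n => u n = false ∧ n ≤ n2) = (Finset.Ioc n1 n2).filter (fun n => ¬ Even n) := by
    ext x
    simp only [Finset.mem_filter, Finset.mem_Ioc]
    constructor
    · rintro ⟨⟨a, b⟩, c, d⟩
      rw [hu x (by omega), decide_eq_false_iff_not] at c
      exact ⟨⟨a, d⟩, c⟩
    · rintro ⟨⟨a, b⟩, c⟩
      refine ⟨⟨a, by omega⟩, ?_, b⟩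
      rw [hu x (by omega), decide_eq_false_iff_not]; exact c
  have s1 := sandwich ((Finset.Ioc n2 (n3 - 1)).filter (fun n => Even n))
    ((Finset.Ioc n1 n3).filter (fun n => u n = true ∧ n2 < n)) n3
    (by
      intro x
      simp only [Finset.mem_filter, Finset.mem_Ioc]
      rintro ⟨⟨a, b⟩, c⟩
      refine ⟨⟨by omega, by omega⟩, ?_, a⟩
      rw [hu x (by omega), decide_eq_true_eq]; exact c)
    (by
      intro x
      simp only [Finset.mem_filter, Finset.mem_Ioc, Finset.mem_insert]
      rintro ⟨⟨a, b⟩, c, d⟩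
      by_cases hx : x = n3
      · exact Or.inl hx
      · rw [hu x (by omega), decide_eq_true_eq] at c
        exact Or.inr ⟨⟨d, by omega⟩, c⟩)
  have s2 := sandwich ((Finset.Ioc n2 (n3 - 1)).filter (fun n => ¬ Even n))
    ((Finset.Ioc n1 n3).filter (fun n => u n = false ∧ n2 < n)) n3
    (by
      intro x
      simp only [Finset.mem_filter, Finset.mem_Ioc]
      rintro ⟨⟨a, b⟩, c⟩
      refine ⟨⟨by omega, by omega⟩, ?_, a⟩
      rw [hu x (by omega), decide_eq_false_iff_not]; exact c)
    (by
      intro x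
      simp only [Finset.mem_filter, Finset.mem_Ioc, Finset.mem_insert]
      rintro ⟨⟨a, b⟩, c, d⟩
      by_cases hx : x = n3
      · exact Or.inl hx
      · rw [hu x (by omega), decide_eq_false_iff_not] at c
        exact Or.inr ⟨⟨d, by omega⟩, c⟩)
  rw [e1] at hk
  rw [e2] at hl
  rw [hk'] at s1
  rw [hl'] at s2
  have c1 := cnt_even n1 n2 h12
  have c2 := cnt_odd n1 n2 h12
  have c3 := cnt_even n2 (n3 - 1) (by omega)
  have c4 := cnt_odd n2 (n3 - 1) (by omega)
  rw [hk] at c1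
  rw [hl] at c2
  simp only [abs_le]
  omega

set_option maxHeartbeats 2000000 in
lemma path_ineq (q ε : ℝ) (hq : q ∈ Set.Ioo (0 : ℝ) 1) (hε : 0 < ε) :
    ∃ T : ℝ, 1 ≤ T ∧ ∀ t₁ t₂ t₃ : ℝ, T ≤ t₂ - t₁ → T ≤ t₃ - t₂ → ∀ a₁ a₃ : ℤ, ∀ a₂ : ℝ,
      (a₂ - (a₁ : ℝ)) / (t₂ - t₁) = ((a₃ : ℝ) - a₂) / (t₃ - t₂) → ∀ (u : ℤ → Bool) (β : ℤ → ℕ),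
      (∀ n, n < ⌊t₃⌋ → u n = decide (Even n)) → (∀ n, n < ⌊t₃⌋ → β n = 0) → β ⌊t₃⌋ ≤ 1 →
      (∑' f : PP ⌊t₁⌋ ⌊t₃⌋ a₁ a₃ u β, ENNReal.ofReal (pngWeight q t₁ t₃ f)) ≤
        2 * (∑' f : PP ⌊t₁⌋ ⌊t₃⌋ a₁ a₃ u β, if a₂ ≤ (f.1 ⌊t₂⌋ : ℝ) then ENNReal.ofReal (pngWeight q t₁ t₃ f) else 0)
        + ENNReal.ofReal ε * (∑' f : PP ⌊t₁⌋ ⌊t₃⌋ a₁ a₃ u β, ENNReal.ofReal (pngWeight q t₁ t₃ f)) ∧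
      (∑' f : PP ⌊t₁⌋ ⌊t₃⌋ a₁ a₃ u β, ENNReal.ofReal (pngWeight q t₁ t₃ f)) ≠ ⊤ ∧
      (∑' f : PP ⌊t₁⌋ ⌊t₃⌋ a₁ a₃ u β, ENNReal.ofReal (pngWeight q t₁ t₃ f)) ≠ 0 := by
  obtain ⟨hq0, hq1⟩ := hq
  have hs : 0 < √q := Real.sqrt_pos.2 hq0
  have hs1 : √q < 1 := by
    rw [Real.sqrt_lt' one_pos]; simpa using hq1
  have hc : 0 < √(1 - q) := Real.sqrt_pos.2 (by linarith)
  obtain ⟨m, hm, H⟩ := main_all (√q) 5 ε hs (by norm_num) hε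
  have hm0 : (1 : ℝ) ≤ m := by exact_mod_cast hm
  refine ⟨2 * m + 3, by linarith, ?_⟩
  intro t₁ t₂ t₃ h12 h23 a₁ a₃ a₂ hcol u β hu hβ hβ1
  obtain ⟨n1, hn1⟩ : ∃ n, n = ⌊t₁⌋ := ⟨_, rfl⟩
  obtain ⟨n2, hn2⟩ : ∃ n, n = ⌊t₂⌋ := ⟨_, rfl⟩
  obtain ⟨n3, hn3⟩ : ∃ n, n = ⌊t₃⌋ := ⟨_, rfl⟩
  have f1 := Int.floor_le t₁
  have f1' := Int.lt_floor_add_one t₁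
  have f2 := Int.floor_le t₂
  have f2' := Int.lt_floor_add_one t₂
  have f3 := Int.floor_le t₃
  have f3' := Int.lt_floor_add_one t₃
  unfold pngWeight
  rw [← hn1] at f1 f1' ⊢
  rw [← hn2] at f2 f2' ⊢
  rw [← hn3] at f3 f3' hu hβ hβ1 ⊢
  have h12' : n1 ≤ n2 := by
    have : (n1 : ℝ) < n2 := by linarith
    exact_mod_cast this.le
  have h23' : n2 < n3 := by
    have : (n2 : ℝ) < n3 := by linarith
    exact_mod_cast this
  obtain ⟨k, hk⟩ : ∃ k, Fintype.card {i : Ix n1 n3 // (u i, decide (i.1 ≤ n2)) = (true, true)} = k := ⟨_, rfl⟩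
  obtain ⟨k', hk'⟩ : ∃ k, Fintype.card {i : Ix n1 n3 // (u i, decide (i.1 ≤ n2)) = (true, false)} = k := ⟨_, rfl⟩
  obtain ⟨l, hl⟩ : ∃ k, Fintype.card {i : Ix n1 n3 // (u i, decide (i.1 ≤ n2)) = (false, true)} = k := ⟨_, rfl⟩
  obtain ⟨l', hl'⟩ : ∃ k, Fintype.card {i : Ix n1 n3 // (u i, decide (i.1 ≤ n2)) = (false, false)} = k := ⟨_, rfl⟩
  obtain ⟨S, hS⟩ : ∃ S, S = a₃ - a₁ - ∑ i : Ix n1 n3, sg (u i) * (β i : ℤ) := ⟨_, rfl⟩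
  obtain ⟨b1, b2, b3, b4⟩ := counts n1 n2 n3 h12' h23' u hu k k' l l' hk hk' hl hl'
  have r1 : |2 * (k : ℝ) - (n2 - n1)| ≤ 1 := by exact_mod_cast b1
  have r2 : |2 * (l : ℝ) - (n2 - n1)| ≤ 1 := by exact_mod_cast b2
  have r3 : |2 * (k' : ℝ) - (n3 - n2)| ≤ 2 := by exact_mod_cast b3
  have r4 : |2 * (l' : ℝ) - (n3 - n2)| ≤ 2 := by exact_mod_cast b4
  rw [abs_le] at r1 r2 r3 r4
  have mk : m ≤ k := by
    have : (m : ℝ) ≤ k := by linarith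
    exact_mod_cast this
  have mk' : m ≤ k' := by
    have : (m : ℝ) ≤ k' := by linarith
    exact_mod_cast this
  have ml : m ≤ l := by
    have : (m : ℝ) ≤ l := by linarith
    exact_mod_cast this
  have ml' : m ≤ l' := by
    have : (m : ℝ) ≤ l' := by linarith
    exact_mod_cast this
  obtain ⟨τ, hτ⟩ : ∃ τ, τ = (t₂ - t₁) / (t₃ - t₁) := ⟨_, rfl⟩
  have hpos : 0 < t₃ - t₁ := by linarith
  have hτ0 : 0 ≤ τ := by rw [hτ]; apply div_nonneg <;> linarith
  have hτ1 : τ ≤ 1 := by rw [hτ, div_le_one hpos]; linarith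
  have hτm : τ * (t₃ - t₁) = t₂ - t₁ := by rw [hτ]; field_simp
  have gen : ∀ x y : ℝ, |2 * x - (t₂ - t₁)| ≤ 2 → |2 * y - (t₃ - t₂)| ≤ 3 → |x - τ * (x + y)| ≤ 5 := by
    intro x y hx hy
    have e : x - τ * (x + y) = (1 - τ) * ((2 * x - (t₂ - t₁)) / 2) - τ * ((2 * y - (t₃ - t₂)) / 2) := by
      linear_combination (-1 / 2 : ℝ) * hτm
    rw [abs_le] at hx hy
    rw [e, abs_le]
    constructor <;> nlinarith
  have hcol' : a₂ - a₁ = τ * (a₃ - a₁) := by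
    rw [div_eq_div_iff (by linarith) (by linarith)] at hcol
    rw [hτ, div_mul_eq_mul_div, eq_div_iff hpos.ne']
    linear_combination hcol
  have hSb : |((∑ i : Ix n1 n3, sg (u i) * (β i : ℤ) : ℤ) : ℝ)| ≤ 1 := by
    have : |(∑ i : Ix n1 n3, sg (u i) * (β i : ℤ) : ℤ)| ≤ 1 := by
      rw [Finset.sum_eq_single ⟨n3, Finset.mem_Ioc.2 ⟨by omega, le_rfl⟩⟩]
      · rcases sg_cases (u n3) with h | h <;> simp only [h] <;> rw [abs_le] <;> omega
      · intro j _ hj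
        have h1 : j.1 ≠ n3 := fun h => hj (Subtype.ext h)
        have h2 := (Finset.mem_Ioc.1 j.2).2
        rw [hβ _ (by omega)]; simp
      · simp
    exact_mod_cast this
  have h := H k k' l l' mk mk' ml ml' τ (gen _ _ (by rw [abs_le]; constructor <;> linarith)
      (by rw [abs_le]; constructor <;> linarith))
      (gen _ _ (by rw [abs_le]; constructor <;> linarith) (by rw [abs_le]; constructor <;> linarith))
      (by rw [abs_le]; constructor <;> linarith) S (a₂ - a₁)
      (by
        rw [hS, hcol']; push_cast at hSb ⊢
        rw [show τ * ((a₃ : ℝ) - a₁) - τ * (a₃ - a₁ - ∑ i : Ix n1 n3, (sg (u i) : ℝ) * (β i : ℝ)) =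
          τ * ∑ i : Ix n1 n3, (sg (u i) : ℝ) * (β i : ℝ) by ring, abs_mul, abs_of_nonneg hτ0]
        exact mul_le_one₀ hτ1 (abs_nonneg _) hSb)
  have p1 := path_sum n1 n2 n3 a₁ a₃ (by omega) u β (fun n hn => hβ n (by omega)) (√(1 - q)) (√q) hc.le hs.le
    (fun _ => 1) k k' l l' S hS hk hk' hl hl'
  have p2 := path_sum n1 n2 n3 a₁ a₃ (by omega) u β (fun n hn => hβ n (by omega)) (√(1 - q)) (√q) hc.le hs.le
    (fun j => if a₂ - a₁ ≤ (j : ℝ) then 1 else 0) k k' l l' S hS hk hk' hl hl'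
  simp only [one_mul] at p1
  simp only [ite_mul, one_mul, zero_mul] at p2
  push_cast at p2
  simp only [sub_le_sub_iff_right] at p2
  rw [p1, p2]
  set C := ENNReal.ofReal (√(1 - q) ^ Fintype.card (Ix n1 n3) * √q ^ (∑ i : Ix n1 n3, β i)) with hC
  have hC0 : C ≠ 0 := by
    rw [hC, Ne, ENNReal.ofReal_eq_zero, not_le]; positivity
  refine ⟨?_, ?_, ?_⟩
  · calc _ ≤ C * _ := mul_le_mul_right h C
      _ = _ := by ring
  · exact ENNReal.mul_ne_top ENNReal.ofReal_ne_top
      (trm_ne_top (fun i : Ix n1 n3 => u i) (fun i => decide (i.1 ≤ n2)) hs.le hs1 S k k' l l' hk hk' hl hl')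
  · exact mul_ne_zero hC0 (trm_ne_zero hs S (by omega) (by omega) (by omega) (by omega))

lemma ex_up (d : ℤ) : (∃ v : ℕ, d = sg true * ((v : ℤ) + (0 : ℕ))) ↔ 0 ≤ d := by
  simp only [sg, if_true]
  constructor
  · rintro ⟨v, rfl⟩; simp
  · intro h; exact ⟨d.toNat, by simp; omega⟩

lemma ex_down (d : ℤ) (b : ℕ) : (∃ v : ℕ, d = sg false * ((v : ℤ) + (b : ℕ))) ↔ d ≤ -b := by
  have : sg false = -1 := rfl
  simp only [this]
  constructor
  · rintro ⟨v, rfl⟩; omega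
  · intro h; exact ⟨(-d - b).toNat, by omega⟩

lemma ex_even (f : ℤ → ℤ) (n : ℤ) :
    (∃ v : ℕ, f n - f (n - 1) = sg (decide (Even n)) * ((v : ℤ) + (0 : ℕ))) ↔
      ((Even n → f (n - 1) ≤ f n) ∧ (Odd n → f n ≤ f (n - 1))) := by
  by_cases h : Even n
  · have h' : ¬ Odd n := by rwa [Int.not_odd_iff_even]
    rw [decide_eq_true h, ex_up]
    constructor
    · intro hh; exact ⟨fun _ => by omega, fun ho => absurd ho h'⟩
    · intro hh; have := hh.1 h; omega
  · have h' : Odd n := by rwa [← Int.not_even_iff_odd]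
    rw [decide_eq_false h, ex_down]
    constructor
    · intro hh; exact ⟨fun he => absurd he h, fun _ => by simp at hh; omega⟩
    · intro hh; have := hh.2 h'; simp; omega

def GG (t₁ t₃ : ℝ) (a₁ a₃ : ℤ) : Set (ℤ → ℤ) := {f | f ∈ PNGLineOn t₁ t₃ ∧ f ⌊t₁⌋ = a₁ ∧ f ⌊t₃⌋ = a₃}

lemma GG_nonint (t₁ t₃ : ℝ) (a₁ a₃ : ℤ) (h : (⌊t₃⌋ : ℝ) < t₃) :
    GG t₁ t₃ a₁ a₃ = PP ⌊t₁⌋ ⌊t₃⌋ a₁ a₃ (fun n => decide (Even n)) (fun _ => 0) := by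
  ext f
  simp only [GG, PP, PNGLineOn, PNGJump, Set.mem_ofPred_eq, ex_even]
  constructor
  · rintro ⟨⟨hj, h1, h3⟩, e1, e3⟩
    refine ⟨fun m hm => by rw [h1 m hm, e1], fun m hm => by rw [h3 m hm, e3], fun n hn hn' => ?_⟩
    refine hj n (Int.floor_lt.1 hn) (lt_of_le_of_lt ?_ h)
    exact_mod_cast hn'
  · rintro ⟨h1, h3, hj⟩
    have e1 := h1 _ le_rfl
    have e3 := h3 _ le_rfl
    refine ⟨⟨fun n hn hn' => ?_, fun m hm => by rw [h1 m hm, e1], fun m hm => by rw [h3 m hm, e3]⟩, e1, e3⟩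
    exact hj n (Int.floor_lt.2 hn) (Int.le_floor.2 hn'.le)

lemma GG_int (t₁ t₃ : ℝ) (a₁ a₃ : ℤ) (h13 : ⌊t₁⌋ < ⌊t₃⌋) (h : (⌊t₃⌋ : ℝ) = t₃) :
    GG t₁ t₃ a₁ a₃ =
      PP ⌊t₁⌋ ⌊t₃⌋ a₁ a₃ (fun n => if n = ⌊t₃⌋ then true else decide (Even n)) (fun _ => 0) ∪
      PP ⌊t₁⌋ ⌊t₃⌋ a₁ a₃ (fun n => if n = ⌊t₃⌋ then false else decide (Even n))
        (fun n => if n = ⌊t₃⌋ then 1 else 0) := by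
  ext f
  simp only [GG, PP, PNGLineOn, PNGJump, Set.mem_ofPred_eq, Set.mem_union]
  constructor
  · rintro ⟨⟨hj, h1, h3⟩, e1, e3⟩
    have hj' : ∀ n, ⌊t₁⌋ < n → n < ⌊t₃⌋ → _ := fun n hn hn' => (ex_even f n).2 (hj n (Int.floor_lt.1 hn) (by
      rw [← h]; exact_mod_cast hn'))
    rcases le_or_gt 0 (f ⌊t₃⌋ - f (⌊t₃⌋ - 1)) with hd | hd
    · left
      refine ⟨fun m hm => by rw [h1 m hm, e1], fun m hm => by rw [h3 m hm, e3], fun n hn hn' => ?_⟩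
      by_cases hnn : n = ⌊t₃⌋
      · subst hnn; rw [if_pos rfl]; exact (ex_up _).2 hd
      · rw [if_neg hnn]; exact hj' n hn (by omega)
    · right
      refine ⟨fun m hm => by rw [h1 m hm, e1], fun m hm => by rw [h3 m hm, e3], fun n hn hn' => ?_⟩
      by_cases hnn : n = ⌊t₃⌋
      · subst hnn; rw [if_pos rfl, if_pos rfl]; exact (ex_down _ _).2 (by push_cast; omega)
      · rw [if_neg hnn, if_neg hnn]; exact hj' n hn (by omega)
  · rintro (⟨h1, h3, hj⟩ | ⟨h1, h3, hj⟩)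
    all_goals
      have e1 := h1 _ le_rfl
      have e3 := h3 _ le_rfl
      refine ⟨⟨fun n hn hn' => ?_, fun m hm => by rw [h1 m hm, e1], fun m hm => by rw [h3 m hm, e3]⟩, e1, e3⟩
      rw [← h] at hn'
      have hn3 : n < ⌊t₃⌋ := by exact_mod_cast hn'
      have := hj n (Int.floor_lt.2 hn) hn3.le
      simp only [if_neg hn3.ne] at this
      exact (ex_even f n).1 this

lemma PP_disj (n1 n3 a₁ a₃ : ℤ) (h13 : n1 < n3) :
    Disjoint (PP n1 n3 a₁ a₃ (fun n => if n = n3 then true else decide (Even n)) (fun _ => 0))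
      (PP n1 n3 a₁ a₃ (fun n => if n = n3 then false else decide (Even n))
        (fun n => if n = n3 then 1 else 0)) := by
  rw [Set.disjoint_left]
  rintro f ⟨_, _, h⟩ ⟨_, _, h'⟩
  have g := h n3 h13 le_rfl
  have g' := h' n3 h13 le_rfl
  beta_reduce at g g'
  rw [if_pos rfl] at g
  rw [if_pos rfl, if_pos rfl] at g'
  have := (ex_up _).1 g
  have := (ex_down _ _).1 g'
  push_cast at *
  omega

lemma pngWeight_nonneg (q t₁ t₃ : ℝ) (f : ℤ → ℤ) : 0 ≤ pngWeight q t₁ t₃ f := by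
  unfold pngWeight
  exact Finset.prod_nonneg fun i _ => by positivity

lemma GG_ineq (q ε : ℝ) (hq : q ∈ Set.Ioo (0 : ℝ) 1) (hε : 0 < ε) :
    ∃ T : ℝ, 1 ≤ T ∧ ∀ t₁ t₂ t₃ : ℝ, T ≤ t₂ - t₁ → T ≤ t₃ - t₂ → ∀ a₁ a₃ : ℤ, ∀ a₂ : ℝ,
      (a₂ - (a₁ : ℝ)) / (t₂ - t₁) = ((a₃ : ℝ) - a₂) / (t₃ - t₂) →
      (∑' f : GG t₁ t₃ a₁ a₃, ENNReal.ofReal (pngWeight q t₁ t₃ f)) ≤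
        2 * (∑' f : GG t₁ t₃ a₁ a₃, if a₂ ≤ (f.1 ⌊t₂⌋ : ℝ) then ENNReal.ofReal (pngWeight q t₁ t₃ f) else 0)
        + ENNReal.ofReal ε * (∑' f : GG t₁ t₃ a₁ a₃, ENNReal.ofReal (pngWeight q t₁ t₃ f)) ∧
      (∑' f : GG t₁ t₃ a₁ a₃, ENNReal.ofReal (pngWeight q t₁ t₃ f)) ≠ ⊤ ∧
      (∑' f : GG t₁ t₃ a₁ a₃, ENNReal.ofReal (pngWeight q t₁ t₃ f)) ≠ 0 := by
  obtain ⟨T, hT, H⟩ := path_ineq q ε hq hε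
  refine ⟨T, hT, ?_⟩
  intro t₁ t₂ t₃ h12 h23 a₁ a₃ a₂ hcol
  rcases (Int.floor_le t₃).lt_or_eq with h | h
  · rw [GG_nonint t₁ t₃ a₁ a₃ h]
    exact H t₁ t₂ t₃ h12 h23 a₁ a₃ a₂ hcol _ _ (fun _ _ => rfl) (fun _ _ => rfl) (by simp)
  · have h13 : ⌊t₁⌋ < ⌊t₃⌋ := by
      rw [Int.floor_lt, h]; linarith
    rw [GG_int t₁ t₃ a₁ a₃ h13 h]
    have hd := PP_disj ⌊t₁⌋ ⌊t₃⌋ a₁ a₃ h13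
    obtain ⟨x1, x2, x3⟩ := H t₁ t₂ t₃ h12 h23 a₁ a₃ a₂ hcol (fun n => if n = ⌊t₃⌋ then true else decide (Even n)) (fun _ => 0)
      (fun n hn => if_neg hn.ne) (fun _ _ => rfl) (by simp)
    obtain ⟨y1, y2, y3⟩ := H t₁ t₂ t₃ h12 h23 a₁ a₃ a₂ hcol (fun n => if n = ⌊t₃⌋ then false else decide (Even n))
      (fun n => if n = ⌊t₃⌋ then 1 else 0)
      (fun n hn => if_neg hn.ne) (fun n hn => if_neg hn.ne) (by simp)
    have s1 := ENNReal.summable.tsum_union_disjoint (f := fun f : ℤ → ℤ => ENNReal.ofReal (pngWeight q t₁ t₃ f)) hd ENNReal.summable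
    have s2 := ENNReal.summable.tsum_union_disjoint (f := fun f : ℤ → ℤ => if a₂ ≤ (f ⌊t₂⌋ : ℝ) then
      ENNReal.ofReal (pngWeight q t₁ t₃ f) else 0) hd ENNReal.summable
    rw [s1, s2]
    refine ⟨?_, ENNReal.add_ne_top.2 ⟨x2, y2⟩, fun h0 => x3 (add_eq_zero.1 h0).1⟩
    calc _ ≤ _ := add_le_add x1 y1
      _ = _ := by ring

lemma prob_ge (q ε : ℝ) (hq : q ∈ Set.Ioo (0 : ℝ) 1) (hε : 0 < ε) :
    ∃ T : ℝ, 1 ≤ T ∧ ∀ t₁ t₂ t₃ : ℝ, T ≤ t₂ - t₁ → T ≤ t₃ - t₂ → ∀ a₁ a₃ : ℤ, ∀ a₂ : ℝ,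
      (a₂ - (a₁ : ℝ)) / (t₂ - t₁) = ((a₃ : ℝ) - a₂) / (t₃ - t₂) →
      1 / 2 - ε ≤ pngProb q t₁ t₃ (GG t₁ t₃ a₁ a₃) {f | a₂ ≤ (f ⌊t₂⌋ : ℝ)} := by
  obtain ⟨T, hT, H⟩ := GG_ineq q ε hq hε
  refine ⟨T, hT, ?_⟩
  intro t₁ t₂ t₃ h12 h23 a₁ a₃ a₂ hcol
  obtain ⟨x1, x2, x3⟩ := H t₁ t₂ t₃ h12 h23 a₁ a₃ a₂ hcol
  have eN : (∑' f : GG t₁ t₃ a₁ a₃, if a₂ ≤ (f.1 ⌊t₂⌋ : ℝ) then ENNReal.ofReal (pngWeight q t₁ t₃ f) else 0) =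
      ∑' f : ↥(GG t₁ t₃ a₁ a₃ ∩ {f | a₂ ≤ (f ⌊t₂⌋ : ℝ)}), ENNReal.ofReal (pngWeight q t₁ t₃ f) := by
    rw [tsum_subtype (GG t₁ t₃ a₁ a₃) (fun f => if a₂ ≤ (f ⌊t₂⌋ : ℝ) then ENNReal.ofReal (pngWeight q t₁ t₃ f) else 0),
      tsum_subtype (GG t₁ t₃ a₁ a₃ ∩ {f | a₂ ≤ (f ⌊t₂⌋ : ℝ)}) (fun f => ENNReal.ofReal (pngWeight q t₁ t₃ f))]
    apply tsum_congr
    intro f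
    rw [← Set.indicator_indicator]
    congr 1
  have hle : (∑' f : GG t₁ t₃ a₁ a₃, if a₂ ≤ (f.1 ⌊t₂⌋ : ℝ) then ENNReal.ofReal (pngWeight q t₁ t₃ f) else 0) ≤
      ∑' f : GG t₁ t₃ a₁ a₃, ENNReal.ofReal (pngWeight q t₁ t₃ f) := by
    apply ENNReal.tsum_le_tsum
    intro f
    split_ifs
    · exact le_rfl
    · exact zero_le
  rw [eN] at x1 hle
  have toR : ∀ A : Set (ℤ → ℤ), (∑' f : A, ENNReal.ofReal (pngWeight q t₁ t₃ f)).toReal = ∑' f : A, pngWeight q t₁ t₃ f := by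
    intro A
    rw [ENNReal.tsum_toReal_eq (fun _ => ENNReal.ofReal_ne_top)]
    exact tsum_congr fun f => ENNReal.toReal_ofReal (pngWeight_nonneg _ _ _ _)
  unfold pngProb
  rw [← toR, ← toR]
  set Z := ∑' f : GG t₁ t₃ a₁ a₃, ENNReal.ofReal (pngWeight q t₁ t₃ f) with hZ
  set N := ∑' f : ↥(GG t₁ t₃ a₁ a₃ ∩ {f | a₂ ≤ (f ⌊t₂⌋ : ℝ)}), ENNReal.ofReal (pngWeight q t₁ t₃ f) with hN
  have hNt : N ≠ ⊤ := ne_top_of_le_ne_top x2 hle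
  have hZp : 0 < Z.toReal := ENNReal.toReal_pos x3 x2
  have x1' := ENNReal.toReal_mono (ENNReal.add_ne_top.2 ⟨ENNReal.mul_ne_top (by simp) hNt,
    ENNReal.mul_ne_top ENNReal.ofReal_ne_top x2⟩) x1
  rw [ENNReal.toReal_add (ENNReal.mul_ne_top (by simp) hNt) (ENNReal.mul_ne_top ENNReal.ofReal_ne_top x2),
    ENNReal.toReal_mul, ENNReal.toReal_mul, ENNReal.toReal_ofReal hε.le, ENNReal.toReal_ofNat] at x1'
  rw [le_div_iff₀ hZp]
  nlinarith

lemma prob_nonneg (q t₁ t₃ : ℝ) (A E : Set (ℤ → ℤ)) : 0 ≤ pngProb q t₁ t₃ A E :=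
  div_nonneg (tsum_nonneg fun _ => pngWeight_nonneg _ _ _ _) (tsum_nonneg fun _ => pngWeight_nonneg _ _ _ _)

/-- Midpoint lower bound for a free PNG trajectory line, Lemma 6.3. -/
theorem png_midpoint_lower_bound (q : ℝ) (hq : q ∈ Set.Ioo (0 : ℝ) 1) :
    ∃ δf : ℝ → ℝ, (∀ t, 0 < t → 0 < δf t) ∧ AntitoneOn δf (Set.Ioi 0) ∧
      Tendsto δf atTop (nhds 0) ∧
      ∀ t₁ t₂ t₃ : ℝ, t₁ < t₂ → t₂ < t₃ → ∀ a₁ a₃ : ℤ, ∀ a₂ : ℝ,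
        (a₂ - (a₁ : ℝ)) / (t₂ - t₁) = ((a₃ : ℝ) - a₂) / (t₃ - t₂) →
        1 / 2 - δf (min (t₂ - t₁) (t₃ - t₂)) ≤
          pngProb q t₁ t₃
            {f | f ∈ PNGLineOn t₁ t₃ ∧ f ⌊t₁⌋ = a₁ ∧ f ⌊t₃⌋ = a₃}
            {f | a₂ ≤ (f ⌊t₂⌋ : ℝ)} := by
  let B : ℝ → Set ℝ := fun t => {x | x = 0 ∨ ∃ (t₁ t₂ t₃ : ℝ) (a₁ a₃ : ℤ) (a₂ : ℝ), t ≤ t₂ - t₁ ∧ t ≤ t₃ - t₂ ∧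
    (a₂ - (a₁ : ℝ)) / (t₂ - t₁) = ((a₃ : ℝ) - a₂) / (t₃ - t₂) ∧
    x = 1 / 2 - pngProb q t₁ t₃ (GG t₁ t₃ a₁ a₃) {f | a₂ ≤ (f ⌊t₂⌋ : ℝ)}}
  have hB0 : ∀ t, (0 : ℝ) ∈ B t := fun t => Or.inl rfl
  have hBb : ∀ t, BddAbove (B t) := by
    intro t
    refine ⟨1 / 2, ?_⟩
    rintro x (rfl | ⟨t₁, t₂, t₃, a₁, a₃, a₂, _, _, _, rfl⟩)
    · norm_num
    · have := prob_nonneg q t₁ t₃ (GG t₁ t₃ a₁ a₃) {f | a₂ ≤ (f ⌊t₂⌋ : ℝ)}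
      linarith
  have hmono : ∀ s t, s ≤ t → B t ⊆ B s := by
    rintro s t hst x (rfl | ⟨t₁, t₂, t₃, a₁, a₃, a₂, h1, h2, h3, rfl⟩)
    · exact hB0 s
    · exact Or.inr ⟨t₁, t₂, t₃, a₁, a₃, a₂, by linarith, by linarith, h3, rfl⟩
  have hnn : ∀ t, 0 ≤ sSup (B t) := fun t => le_csSup (hBb t) (hB0 t)
  refine ⟨fun t => sSup (B t) + Real.exp (-t), ?_, ?_, ?_, ?_⟩
  · intro t _
    have := hnn t
    have := Real.exp_pos (-t)
    show 0 < sSup (B t) + Real.exp (-t)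
    linarith
  · intro s _ t _ hst
    show sSup (B t) + Real.exp (-t) ≤ sSup (B s) + Real.exp (-s)
    have h1 := csSup_le_csSup (hBb s) ⟨0, hB0 t⟩ (hmono s t hst)
    have h2 : Real.exp (-t) ≤ Real.exp (-s) := Real.exp_le_exp.2 (by linarith)
    linarith
  · have h1 : Tendsto (fun t => sSup (B t)) atTop (nhds 0) := by
      rw [Metric.tendsto_atTop]
      intro ε hε
      obtain ⟨T, _, hT⟩ := prob_ge q (ε / 2) hq (by positivity)
      refine ⟨T, fun t ht => ?_⟩
      rw [Real.dist_eq, sub_zero, abs_of_nonneg (hnn t)]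
      refine lt_of_le_of_lt (csSup_le ⟨0, hB0 t⟩ ?_) (half_lt_self hε)
      rintro x (rfl | ⟨t₁, t₂, t₃, a₁, a₃, a₂, h1, h2, h3, rfl⟩)
      · positivity
      · have := hT t₁ t₂ t₃ (by linarith) (by linarith) a₁ a₃ a₂ h3
        linarith
    have h2 : Tendsto (fun t : ℝ => Real.exp (-t)) atTop (nhds 0) :=
      Real.tendsto_exp_neg_atTop_nhds_zero
    simpa using h1.add h2
  · intro t₁ t₂ t₃ h12 h23 a₁ a₃ a₂ hcol
    show 1 / 2 - (sSup (B (min (t₂ - t₁) (t₃ - t₂))) + Real.exp (-(min (t₂ - t₁) (t₃ - t₂)))) ≤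
      pngProb q t₁ t₃ (GG t₁ t₃ a₁ a₃) {f | a₂ ≤ (f ⌊t₂⌋ : ℝ)}
    have h1 : 1 / 2 - pngProb q t₁ t₃ (GG t₁ t₃ a₁ a₃) {f | a₂ ≤ (f ⌊t₂⌋ : ℝ)} ≤ sSup (B (min (t₂ - t₁) (t₃ - t₂))) :=
      le_csSup (hBb _) (Or.inr ⟨t₁, t₂, t₃, a₁, a₃, a₂, min_le_left _ _, min_le_right _ _, hcol, rfl⟩)
    have := Real.exp_pos (-(min (t₂ - t₁) (t₃ - t₂)))
    linarith

end
end

section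
/- (Limit of the Toeplitz determinants.) For all positive integers M, N, with φ(z) = (1 + √q·z)^M (1 + √q/z)^N and D_n(φ) := det( (1/(2πi)) ∮_{|z|=1} z^{−j+k} φ(z) dz/z )_{j,k=0}^{n−1}, one has lim_{n→∞} D_n(φ) = (1−q)^{−MN}. -/
open Filter

noncomputable section

/-- The `(j,k)` Toeplitz entry of the symbol `φ(z) = (1+√q z)^M (1+√q/z)^N`:
the `(j−k)`-th Fourier coefficient `(2πi)⁻¹ ∮_{|z|=1} z^{−j+k} φ(z) dz/z`. -/
def toeplitzEntry (q : ℝ) (M N : ℕ) (j k : ℤ) : ℂ :=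
  (2 * (Real.pi : ℂ) * Complex.I)⁻¹ *
    ∮ z in C(0, 1), z ^ (-j + k) *
      ((1 + (Real.sqrt q : ℂ) * z) ^ M * (1 + (Real.sqrt q : ℂ) / z) ^ N) / z

/-- The `n`-th Toeplitz determinant `D_n(φ)` (with `D₀(φ) = 1`). -/
def toeplitzDet (q : ℝ) (M N : ℕ) (n : ℕ) : ℂ :=
  Matrix.det (Matrix.of fun j k : Fin n => toeplitzEntry q M N j k)

open Polynomial in
lemma entry_eq (q : ℝ) (M N : ℕ) (j k : ℕ) :
    toeplitzEntry q M N j k =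
      (((1 + C (Real.sqrt q : ℂ) * X) ^ M * (X + C (Real.sqrt q : ℂ)) ^ N) * X ^ k : ℂ[X]).coeff
        (N + j) := by
  set r : ℂ := (Real.sqrt q : ℂ) with hr
  set p : ℂ[X] := ((1 + C r * X) ^ M * (X + C r) ^ N) * X ^ k with hp
  unfold toeplitzEntry
  rw [← hr]
  have h1 : (∮ z in C(0, 1), z ^ (-(j : ℤ) + k) * ((1 + r * z) ^ M * (1 + r / z) ^ N) / z)
      = ∮ z in C(0, 1), ∑ i ∈ Finset.range (p.natDegree + (N + j) + 1),
          p.coeff i * (z - 0) ^ ((i : ℤ) - (N + j : ℕ) - 1) := by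
    apply circleIntegral.integral_congr zero_le_one
    intro z hz
    have hz0 : z ≠ 0 := by
      rintro rfl
      simp at hz
    have he : p.eval z = ∑ i ∈ Finset.range (p.natDegree + (N + j) + 1), p.coeff i * z ^ i :=
      Polynomial.eval_eq_sum_range' (by omega) z
    have he2 : p.eval z = ((1 + r * z) ^ M * (z + r) ^ N) * z ^ k := by
      simp [hp]
    have e3 : ∀ i ∈ Finset.range (p.natDegree + (N + j) + 1),
        p.coeff i * (z - 0) ^ ((i : ℤ) - (N + j : ℕ) - 1)
          = p.coeff i * z ^ i * (z ^ (N + j + 1))⁻¹ := by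
      intro i _
      rw [sub_zero, sub_sub, zpow_sub₀ hz0]
      have : ((N + j : ℕ) : ℤ) + 1 = ((N + j + 1 : ℕ) : ℤ) := by push_cast; ring
      rw [this, zpow_natCast, zpow_natCast]
      ring
    simp only []
    rw [Finset.sum_congr rfl e3, ← Finset.sum_mul, ← he, he2]
    have e4 : 1 + r / z = (z + r) / z := by field_simp
    rw [e4, div_pow, zpow_add₀ hz0, zpow_neg, zpow_natCast, zpow_natCast]
    field_simp
    ring
  rw [h1]
  have hci : ∀ m : ℤ, CircleIntegrable (fun z : ℂ => (z - 0) ^ m) 0 1 := by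
    intro m
    rw [circleIntegrable_sub_zpow_iff]
    right; right
    simp
  rw [circleIntegral.integral_fun_sum]
  · simp_rw [circleIntegral.integral_const_mul]
    rw [Finset.sum_eq_single (N + j)]
    · have : (((N + j : ℕ) : ℤ) - (N + j : ℕ) - 1) = -1 := by ring
      rw [this]
      simp_rw [zpow_neg_one]
      rw [circleIntegral.integral_sub_inv_of_mem_ball (by simp)]
      have := Complex.two_pi_I_ne_zero
      field_simp
    · intro i _ hi
      rw [circleIntegral.integral_sub_zpow_of_ne, mul_zero]
      omega
    · intro h
      exact absurd (Finset.mem_range.2 (by omega)) h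
  · intro i _
    exact (hci _).const_fun_smul (a := p.coeff i)

/-- position in the concatenated index set -/
def posn {N n : ℕ} : Fin N ⊕ Fin n → ℕ := Sum.elim (fun i => (i : ℕ)) (fun i => N + (i : ℕ))

lemma sum_posn {N n : ℕ} (f : ℕ → ℂ) :
    ∑ s : Fin N ⊕ Fin n, f (posn s) = ∑ l ∈ Finset.range (N + n), f l := by
  rw [Fintype.sum_sum_type, Finset.sum_range_add, Finset.sum_range, Finset.sum_range]
  simp [posn]

lemma posn_lt {N n : ℕ} (s : Fin N ⊕ Fin n) : posn s < N + n := by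
  rcases s with s | s <;> simp [posn] <;> omega

open PowerSeries in
lemma conv_sum (c f : PowerSeries ℂ) (i K : ℕ) (h : i < K) :
    ∑ l ∈ Finset.range K, coeff i (c * X ^ l) * coeff l f = coeff i (c * f) := by
  rw [mul_comm c f, coeff_mul, Finset.Nat.sum_antidiagonal_eq_sum_range_succ_mk]
  simp_rw [coeff_mul_X_pow', ite_mul, zero_mul]
  rw [← Finset.sum_subset (Finset.range_mono (Nat.succ_le_of_lt h))]
  · apply Finset.sum_congr rfl
    intro l hl
    rw [if_pos (by simpa [Nat.lt_succ_iff] using hl), mul_comm]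
  · intro l _ hl
    rw [if_neg (by simpa using hl)]

open Matrix in
lemma key_det (N n : ℕ) (p b : Polynomial ℂ) (c : PowerSeries ℂ)
    (hc0 : PowerSeries.coeff 0 c = 1) (hcp : c * (p : PowerSeries ℂ) = b)
    (hbm : b.Monic) (hbd : b.natDegree = N) (v : ℕ → Fin N → ℂ)
    (hv : ∀ k < n, ∀ i, ∑ l ∈ Finset.range (N + n), (b * Polynomial.X ^ k).coeff l * v l i = 0) :
    (Matrix.of fun i m : Fin N => v m i).det *
      (Matrix.of fun j k : Fin n => (p * Polynomial.X ^ (k : ℕ)).coeff (N + j)).det =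
    (Matrix.of fun i m : Fin N => ∑ l ∈ Finset.range (N + n),
      PowerSeries.coeff l (c * PowerSeries.X ^ (m : ℕ)) * v l i).det := by
  let Q : Matrix (Fin N ⊕ Fin n) (Fin N ⊕ Fin n) ℂ :=
    fromBlocks (of fun i m : Fin N => v m i) (of fun i (m : Fin n) => v (N + m) i) 0 1
  let L : Matrix (Fin N ⊕ Fin n) (Fin N ⊕ Fin n) ℂ :=
    of fun s t => PowerSeries.coeff (posn s) (c * PowerSeries.X ^ (posn t))
  let H : Matrix (Fin N ⊕ Fin n) (Fin N ⊕ Fin n) ℂ :=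
    fromBlocks 1 (of fun (i : Fin N) (k : Fin n) => (p * Polynomial.X ^ (k : ℕ)).coeff i)
      0 (of fun j k : Fin n => (p * Polynomial.X ^ (k : ℕ)).coeff (N + j))
  have hQ : Q.det = (Matrix.of fun i m : Fin N => v m i).det := by
    simp [Q, det_fromBlocks_zero₂₁]
  have hH : H.det =
      (Matrix.of fun j k : Fin n => (p * Polynomial.X ^ (k : ℕ)).coeff (N + j)).det := by
    simp [H, det_fromBlocks_zero₂₁]
  have hL : L.det = 1 := by
    have : L = fromBlocks
        (of fun i j : Fin N => PowerSeries.coeff (i : ℕ) (c * PowerSeries.X ^ (j : ℕ))) 0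
        (of fun (i : Fin n) (j : Fin N) =>
          PowerSeries.coeff (N + i : ℕ) (c * PowerSeries.X ^ (j : ℕ)))
        (of fun i j : Fin n => PowerSeries.coeff (N + i : ℕ) (c * PowerSeries.X ^ (N + j : ℕ))) := by
      ext s t
      rcases s with s | s <;> rcases t with t | t <;>
        simp [L, posn]
      rw [PowerSeries.coeff_mul_X_pow', if_neg (by omega)]
    rw [this, det_fromBlocks_zero₁₂, det_of_isLowerTriangular, det_of_isLowerTriangular]
    · simp [PowerSeries.coeff_mul_X_pow', hc0]
    · intro i j hij
      have hij : (i : ℕ) < j := hij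
      simp only [of_apply]
      rw [PowerSeries.coeff_mul_X_pow', if_neg (by omega)]
    · intro i j hij
      have hij : (i : ℕ) < j := hij
      simp only [of_apply]
      rw [PowerSeries.coeff_mul_X_pow', if_neg (by omega)]
  have hLH1 : ∀ s (m : Fin N), (L * H) s (Sum.inl m)
      = PowerSeries.coeff (posn s) (c * PowerSeries.X ^ (m : ℕ)) := by
    intro s m
    rw [Matrix.mul_apply, Finset.sum_eq_single (Sum.inl m)]
    · simp [L, H, posn]
    · rintro (t | t) _ ht
      · have : t ≠ m := fun h => ht (by rw [h])
        simp [H, Matrix.one_apply, this]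
      · simp [H]
    · simp
  have hLH2 : ∀ s (k : Fin n), (L * H) s (Sum.inr k)
      = (b * Polynomial.X ^ (k : ℕ)).coeff (posn s) := by
    intro s k
    have e : ∀ t, H t (Sum.inr k) = (p * Polynomial.X ^ (k : ℕ)).coeff (posn t) := by
      rintro (t | t) <;> simp [H, posn]
    rw [Matrix.mul_apply]
    simp_rw [e]
    have := sum_posn (N := N) (n := n) (fun l => PowerSeries.coeff (posn s) (c * PowerSeries.X ^ l) *
      PowerSeries.coeff l ((p * Polynomial.X ^ (k : ℕ) : Polynomial ℂ) : PowerSeries ℂ))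
    rw [conv_sum _ _ _ _ (posn_lt s)] at this
    rw [show c * ((p * Polynomial.X ^ (k : ℕ) : Polynomial ℂ) : PowerSeries ℂ) =
        ((b * Polynomial.X ^ (k : ℕ) : Polynomial ℂ) : PowerSeries ℂ) by
          rw [Polynomial.coe_mul, ← mul_assoc, hcp, ← Polynomial.coe_mul],
      Polynomial.coeff_coe] at this
    rw [← this]
    apply Finset.sum_congr rfl
    intro t _
    rw [Polynomial.coeff_coe]
    rfl
  have hQG : Q * (L * H) = fromBlocks
      (Matrix.of fun i m : Fin N => ∑ l ∈ Finset.range (N + n),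
        PowerSeries.coeff l (c * PowerSeries.X ^ (m : ℕ)) * v l i) 0
      (of fun (i : Fin n) (m : Fin N) =>
        PowerSeries.coeff (N + i : ℕ) (c * PowerSeries.X ^ (m : ℕ)))
      (of fun i k : Fin n => (b * Polynomial.X ^ (k : ℕ)).coeff (N + i)) := by
    have e : ∀ i t, Q (Sum.inl i) t = v (posn t) i := by
      rintro i (t | t) <;> simp [Q, posn]
    have e2 : ∀ (i : Fin n) t, (Q * (L * H)) (Sum.inr i) t = (L * H) (Sum.inr i) t := by
      intro i t
      rw [Matrix.mul_apply, Finset.sum_eq_single (Sum.inr i)]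
      · simp [Q]
      · rintro (s | s) _ hs
        · simp [Q]
        · have : i ≠ s := fun h => hs (by rw [h])
          simp [Q, Matrix.one_apply, this]
      · simp
    ext s t
    rcases s with s | s <;> rcases t with t | t
    · rw [Matrix.mul_apply]
      simp_rw [hLH1, e]
      simp only [fromBlocks_apply₁₁, of_apply]
      rw [← sum_posn]
      exact Finset.sum_congr rfl fun _ _ => mul_comm _ _
    · rw [Matrix.mul_apply]
      simp_rw [hLH2, e]
      simp only [fromBlocks_apply₁₂, Matrix.zero_apply]
      rw [← hv t t.2 s, ← sum_posn]
      exact Finset.sum_congr rfl fun _ _ => mul_comm _ _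
    · rw [e2, hLH1]; simp [posn]
    · rw [e2, hLH2]; simp [posn]
  have := congrArg Matrix.det hQG
  rw [det_mul, det_mul, hQ, hH, hL, one_mul, det_fromBlocks_zero₁₂] at this
  rw [this, det_of_isUpperTriangular (M := of fun i k : Fin n => _)]
  · have : ∀ i : Fin n, (b * Polynomial.X ^ (i : ℕ)).coeff (N + i) = 1 := by
      intro i
      rw [Polynomial.coeff_mul_X_pow, ← hbd]
      exact hbm
    simp [this]
  · intro i k hik
    have hik : (k : ℕ) < i := hik
    simp only [of_apply]
    apply Polynomial.coeff_eq_zero_of_natDegree_lt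
    rw [hbm.natDegree_mul (Polynomial.monic_X_pow _), Polynomial.natDegree_X_pow]
    omega

/-- lower shift -/
def lshift (N : ℕ) : Matrix (Fin N) (Fin N) ℂ :=
  Matrix.of fun i j => if (i : ℕ) = j + 1 then 1 else 0

/-- Jordan-type block with eigenvalue `-r` -/
def jblock (N : ℕ) (r : ℂ) : Matrix (Fin N) (Fin N) ℂ :=
  (-r) • (1 : Matrix (Fin N) (Fin N) ℂ) + (1 - r) • lshift N

lemma lshift_mul_apply {N : ℕ} (A : Matrix (Fin N) (Fin N) ℂ) (i j : Fin N) :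
    (lshift N * A) i j = if h : 0 < (i : ℕ) then A ⟨i - 1, by omega⟩ j else 0 := by
  rw [Matrix.mul_apply]
  split_ifs with h
  · rw [Finset.sum_eq_single ⟨i - 1, by omega⟩]
    · simp only [lshift, Matrix.of_apply]
      rw [if_pos (by omega), one_mul]
    · intro b _ hb
      simp only [lshift, Matrix.of_apply]
      rw [if_neg, zero_mul]
      intro h'
      apply hb
      ext
      simp only
      omega
    · simp
  · apply Finset.sum_eq_zero
    intro b _
    simp only [lshift, Matrix.of_apply]
    rw [if_neg (by omega), zero_mul]

lemma lshift_pow {N : ℕ} (hN : 0 < N) (m : ℕ) (i : Fin N) :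
    (lshift N ^ m) i ⟨0, hN⟩ = if (i : ℕ) = m then 1 else 0 := by
  induction m generalizing i with
  | zero => simp [Matrix.one_apply, Fin.ext_iff]
  | succ m ih =>
    rw [pow_succ', lshift_mul_apply]
    split_ifs with h1 h2 h2
    · rw [ih, if_pos]; simp only; omega
    · rw [ih, if_neg]; simp only; omega
    · omega
    · rfl

lemma jblock_pow {N : ℕ} (hN : 0 < N) (r : ℂ) (m : ℕ) (i : Fin N) (hi : m ≤ i) :
    (jblock N r ^ m) i ⟨0, hN⟩ = if (i : ℕ) = m then (1 - r) ^ m else 0 := by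
  induction m generalizing i with
  | zero => simp [Matrix.one_apply, Fin.ext_iff]
  | succ m ih =>
    have e : jblock N r ^ (m + 1)
        = (-r) • jblock N r ^ m + (1 - r) • (lshift N * jblock N r ^ m) := by
      rw [pow_succ']
      conv_lhs => enter [1]; rw [jblock]
      rw [add_mul, smul_mul_assoc, one_mul, smul_mul_assoc]
    rw [e, Matrix.add_apply, Matrix.smul_apply, Matrix.smul_apply, lshift_mul_apply,
      dif_pos (by omega), ih _ (by omega), ih _ (by simp only; omega), if_neg (by omega)]
    simp only [smul_eq_mul, mul_zero, zero_add]
    by_cases h : (i : ℕ) = m + 1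
    · rw [if_pos (by omega), if_pos h, pow_succ']
    · rw [if_neg (by omega), if_neg h, mul_zero]

lemma jblock_eval {N : ℕ} (hN : 0 < N) (r : ℂ) (k : ℕ) (i : Fin N) :
    (jblock N r ^ k * (jblock N r + r • (1 : Matrix (Fin N) (Fin N) ℂ)) ^ N) i ⟨0, hN⟩ = 0 := by
  have : jblock N r + r • (1 : Matrix (Fin N) (Fin N) ℂ) = (1 - r) • lshift N := by
    rw [jblock]; module
  rw [this, smul_pow, Matrix.mul_apply]
  apply Finset.sum_eq_zero
  intro j _
  rw [Matrix.smul_apply, lshift_pow, if_neg (by omega)]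
  simp

lemma det_one_add_jblock {N : ℕ} (r : ℂ) :
    (1 + r • jblock N r).det = (1 - r ^ 2) ^ N := by
  rw [Matrix.det_of_isLowerTriangular]
  · have : ∀ i, (1 + r • jblock N r) i i = 1 - r ^ 2 := by
      intro i
      simp [jblock, lshift]; ring
    simp [this]
  · intro i j hij
    have hij : (i : ℕ) < j := hij
    have h1 : i ≠ j := by rintro rfl; omega
    have h2 : ¬ ((i : ℕ) = j + 1) := by omega
    simp [jblock, lshift, Matrix.one_apply, h1, h2]

section
attribute [local instance] Matrix.linftyOpNormedRing Matrix.linftyOpNormedAlgebra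

lemma jblock_norm {N : ℕ} (hN : 0 < N) (r : ℝ) (h0 : 0 ≤ r) (h1 : r < 1) :
    ‖jblock N (r : ℂ)‖ ≤ 1 := by
  have : Nonempty (Fin N) := ⟨⟨0, hN⟩⟩
  have hS : ‖lshift N‖ ≤ 1 := by
    rw [Matrix.linfty_opNorm_def]
    norm_cast
    apply Finset.sup_le
    intro i _
    by_cases h : 0 < (i : ℕ)
    · rw [Finset.sum_eq_single ⟨i - 1, by omega⟩]
      · simp only [lshift, Matrix.of_apply]
        split_ifs <;> simp
      · intro b _ hb
        simp only [lshift, Matrix.of_apply]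
        rw [if_neg, nnnorm_zero]
        intro h'
        apply hb
        ext
        simp only
        omega
      · simp
    · rw [Finset.sum_eq_zero]
      · simp
      · intro b _
        simp only [lshift, Matrix.of_apply]
        rw [if_neg (by omega), nnnorm_zero]
  have hI : ‖(1 : Matrix (Fin N) (Fin N) ℂ)‖ ≤ 1 := by
    rw [← Matrix.diagonal_one, Matrix.linfty_opNorm_diagonal]
    simp [Pi.norm_def]
  have hr : ‖(-(r : ℂ))‖ = r := by simp [abs_of_nonneg h0]
  have hr' : ‖(1 - (r : ℂ))‖ = 1 - r := by
    rw [← Complex.ofReal_one, ← Complex.ofReal_sub, Complex.norm_real, Real.norm_eq_abs,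
      abs_of_nonneg (by linarith)]
  calc ‖jblock N (r : ℂ)‖ ≤ ‖(-(r : ℂ)) • (1 : Matrix (Fin N) (Fin N) ℂ)‖
        + ‖(1 - (r : ℂ)) • lshift N‖ := norm_add_le _ _
    _ ≤ r * 1 + (1 - r) * 1 := by
        rw [norm_smul, norm_smul, hr, hr']
        gcongr
    _ = 1 := by ring

lemma jblock_hasSum {N : ℕ} (hN : 0 < N) (d : ℕ) (r : ℝ) (h0 : 0 ≤ r) (h1 : r < 1) :
    ∃ Y : Matrix (Fin N) (Fin N) ℂ, Y.det * ((1 - (r : ℂ) ^ 2) ^ N) ^ (d + 1) = 1 ∧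
      ∀ i j, HasSum (fun l : ℕ => ((-(r : ℂ)) ^ l * (Nat.choose (d + l) d : ℂ)) *
        (jblock N (r : ℂ) ^ l) i j) (Y i j) := by
  have hn : ‖(-(r : ℂ)) • jblock N (r : ℂ)‖ < 1 := by
    rw [norm_smul]
    have : ‖(-(r : ℂ))‖ = r := by simp [abs_of_nonneg h0]
    rw [this]
    have := jblock_norm hN r h0 h1
    nlinarith [norm_nonneg (jblock N (r : ℂ))]
  have hs := hasSum_choose_mul_geometric_of_norm_lt_one' d hn
  refine ⟨Ring.inverse (1 - (-(r : ℂ)) • jblock N (r : ℂ)) ^ (d + 1), ?_, ?_⟩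
  rotate_left 1
  · intro i j
    have h := Pi.hasSum.1 (Pi.hasSum.1 hs i) j
    convert h using 2 with l
    rw [smul_pow, ← nsmul_eq_mul, ← Nat.cast_smul_eq_nsmul ℂ, smul_smul, Matrix.smul_apply,
      smul_eq_mul, mul_comm ((-(r : ℂ)) ^ l), add_comm d l]
  · have e : 1 - (-(r : ℂ)) • jblock N (r : ℂ) = 1 + (r : ℂ) • jblock N (r : ℂ) := by module
    rw [e, ← det_one_add_jblock, ← Matrix.det_pow, ← Matrix.det_mul, ← Matrix.det_one (n := Fin N)]
    congr 1
    have hu : IsUnit (1 + (r : ℂ) • jblock N (r : ℂ)) := by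
      rw [← e]; exact isUnit_one_sub_of_norm_lt_one hn
    have hc : Commute (Ring.inverse (1 + (r : ℂ) • jblock N (r : ℂ)))
        (1 + (r : ℂ) • jblock N (r : ℂ)) := by
      rw [Commute, SemiconjBy, Ring.inverse_mul_cancel _ hu, Ring.mul_inverse_cancel _ hu]
    rw [← hc.mul_pow, Ring.inverse_mul_cancel _ hu, one_pow]

end


/-- Limit of the Toeplitz determinants. -/
theorem toeplitz_det_limit (q : ℝ) (hq : q ∈ Set.Ioo (0 : ℝ) 1)
    (M N : ℕ) (hM : 0 < M) (hN : 0 < N) :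
    Tendsto (fun n : ℕ => toeplitzDet q M N n) atTop
      (nhds (((1 - (q : ℂ)) ^ (M * N))⁻¹)) := by
  obtain ⟨d, rfl⟩ : ∃ d, M = d + 1 := ⟨M - 1, by omega⟩
  obtain ⟨hq0, hq1⟩ := hq
  have hr0 : 0 ≤ Real.sqrt q := Real.sqrt_nonneg q
  have hr1 : Real.sqrt q < 1 := by
    rw [Real.sqrt_lt' one_pos]; simpa using hq1
  have hrq : ((Real.sqrt q : ℝ) : ℂ) ^ 2 = q := by
    rw [← Complex.ofReal_pow, Real.sq_sqrt hq0.le]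
  have hr1c : (1 - ((Real.sqrt q : ℝ) : ℂ)) ≠ 0 := by
    rw [← Complex.ofReal_one, ← Complex.ofReal_sub, Complex.ofReal_ne_zero]
    linarith
  obtain ⟨Y, hYdet, hY⟩ := jblock_hasSum hN d (Real.sqrt q) hr0 hr1
  rw [hrq] at hYdet
  have hent := fun j k : ℕ => entry_eq q (d + 1) N j k
  generalize ((Real.sqrt q : ℝ) : ℂ) = r at hent hY hr1c
  set Z := jblock N r with hZ
  let a : Polynomial ℂ := (1 + Polynomial.C r * Polynomial.X) ^ (d + 1)
  let b : Polynomial ℂ := (Polynomial.X + Polynomial.C r) ^ N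
  let c : PowerSeries ℂ := PowerSeries.rescale (-r) (PowerSeries.mk fun n => (Nat.choose (d + n) d : ℂ))
  let v : ℕ → Fin N → ℂ := fun m i => (Z ^ m) i ⟨0, hN⟩
  have hcc : ∀ l, PowerSeries.coeff l c = (-r) ^ l * (Nat.choose (d + l) d : ℂ) := by
    intro l
    simp [c, PowerSeries.coeff_rescale]
  have hc0 : PowerSeries.coeff 0 c = 1 := by
    rw [hcc]; simp
  have hca : c * (a : PowerSeries ℂ) = 1 := by
    have h := congrArg (PowerSeries.rescale (-r)) (PowerSeries.mk_add_choose_mul_one_sub_pow_eq_one ℂ d)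
    rw [map_mul, map_pow, map_sub, map_one, PowerSeries.rescale_X] at h
    rw [← h]
    congr 1
    simp [a]
  have hcp : c * ((a * b : Polynomial ℂ) : PowerSeries ℂ) = b := by
    rw [Polynomial.coe_mul, ← mul_assoc, hca, one_mul]
  have hbm : b.Monic := (Polynomial.monic_X_add_C r).pow N
  have hbd : b.natDegree = N := by
    simp [b, Polynomial.natDegree_pow]
  have hv : ∀ n : ℕ, ∀ k < n, ∀ i,
      ∑ l ∈ Finset.range (N + n), (b * Polynomial.X ^ k).coeff l * v l i = 0 := by
    intro n k hk i
    have h1 : (b * Polynomial.X ^ k).natDegree < N + n := by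
      rw [hbm.natDegree_mul (Polynomial.monic_X_pow _), Polynomial.natDegree_X_pow]
      omega
    have h2 := Polynomial.aeval_eq_sum_range' h1 Z
    have h3 : Polynomial.aeval Z (b * Polynomial.X ^ k)
        = Z ^ k * (Z + r • (1 : Matrix (Fin N) (Fin N) ℂ)) ^ N := by
      rw [mul_comm b]
      simp [b, Algebra.algebraMap_eq_smul_one]
    rw [h3] at h2
    have h4 := congrFun (congrFun h2 i) ⟨0, hN⟩
    rw [jblock_eval hN, Matrix.sum_apply] at h4
    rw [h4]
    rfl
  let E : Matrix (Fin N) (Fin N) ℂ := Matrix.of fun i m : Fin N => v m i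
  let F : ℕ → Matrix (Fin N) (Fin N) ℂ := fun n => Matrix.of fun i m : Fin N =>
    ∑ l ∈ Finset.range (N + n), PowerSeries.coeff l (c * PowerSeries.X ^ (m : ℕ)) * v l i
  have hE : E.det ≠ 0 := by
    rw [Matrix.det_of_isUpperTriangular]
    · rw [Finset.prod_ne_zero_iff]
      intro i _
      simp only [E, v, Matrix.of_apply]
      rw [jblock_pow hN r i i le_rfl, if_pos rfl]
      exact pow_ne_zero _ hr1c
    · intro i j hij
      have hij : (j : ℕ) < i := hij
      simp only [E, v, Matrix.of_apply]
      rw [jblock_pow hN r j i hij.le, if_neg (by omega)]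
  have hdet : ∀ n, toeplitzDet q (d + 1) N n = E.det⁻¹ * (F n).det := by
    intro n
    have h := key_det N n (a * b) b c hc0 hcp hbm hbd v (hv n)
    rw [eq_inv_mul_iff_mul_eq₀ hE, ← h]
    unfold toeplitzDet
    congr 2
    ext j k
    exact hent j k
  have hF : Tendsto F atTop (nhds (Y * E)) := by
    refine tendsto_pi_nhds.2 fun i => tendsto_pi_nhds.2 fun m => ?_
    have hs : HasSum (fun l : ℕ => PowerSeries.coeff l (c * PowerSeries.X ^ (m : ℕ)) * v l i)
        ((Y * E) i m) := by
      rw [← hasSum_nat_add_iff' (m : ℕ), Finset.sum_eq_zero, sub_zero]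
      · rw [Matrix.mul_apply]
        have := hasSum_sum (s := Finset.univ) (fun j (_ : j ∈ Finset.univ) =>
          (hY i j).mul_right (E j m))
        refine Eq.mp (congrArg (fun f : ℕ → ℂ => HasSum f _) (funext fun l => ?_)) this
        rw [PowerSeries.coeff_mul_X_pow, hcc]
        simp only [v, E, Matrix.of_apply, pow_add, Matrix.mul_apply, Finset.mul_sum, mul_assoc]
      · intro l hl
        rw [PowerSeries.coeff_mul_X_pow', if_neg (by simpa using hl), zero_mul]
    have ht := hs.tendsto_sum_nat.comp (tendsto_add_atTop_nat N)
    refine ht.congr fun n => ?_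
    simp only [Function.comp, F, Matrix.of_apply, add_comm n N]
  have hlim : Tendsto (fun n => E.det⁻¹ * (F n).det) atTop (nhds (E.det⁻¹ * (Y * E).det)) :=
    (((continuous_id.matrix_det).tendsto _).comp hF).const_mul _
  have hval : E.det⁻¹ * (Y * E).det = ((1 - (q : ℂ)) ^ ((d + 1) * N))⁻¹ := by
    rw [Matrix.det_mul, mul_comm (d + 1) N, pow_mul, mul_comm Y.det, inv_mul_cancel_left₀ hE]
    exact eq_inv_of_mul_eq_one_left hYdet
  rw [← hval]
  exact hlim.congr fun n => (hdet n).symm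

end
end
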